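/- arXiv:1508.00098 — 4 statements merged into one kernel-verified Lean document; each statement's English description precedes it below -/
import Mathlib

section
/- For every integer v with v ≡ 1 (mod 3) and v ≥ 10, there exists a super-simple 2-(v,4,2) directed design in which every defining set contains at least half of the total number of blocks (i.e., d ≥ 1/2). -/
/-- A `t-(v,k,λ)` directed design on the point type `X`: a collection of
blocks, each an ordered `k`-tuple (a duplicate-free list of length `k`) of
points, such that every ordered `t`-tuple of distinct points occurs, in the
given order (i.e. as a sublist), in exactly `lam` blocks. -/
structure DirectedDesign (X : Type*) [DecidableEq X] (t k lam : ℕ) where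
  blocks : Multiset (List X)
  len : ∀ b ∈ blocks, b.length = k
  nodup : ∀ b ∈ blocks, b.Nodup
  covers : ∀ s : List X, s.length = t → s.Nodup →
    blocks.countP (fun b => s.Sublist b) = lam

/-- A directed design is super-simple if it has no repeated blocks and any two
distinct blocks have at most 2 points in common. -/
def DirectedDesign.SuperSimple {X : Type*} [DecidableEq X] {t k lam : ℕ}
    (D : DirectedDesign X t k lam) : Prop :=
  D.blocks.Nodup ∧
    ∀ b₁ ∈ D.blocks, ∀ b₂ ∈ D.blocks, b₁ ≠ b₂ →
      (b₁.toFinset ∩ b₂.toFinset).card ≤ 2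

/-- `S` is a defining set of the directed design `D` if `S` is a
subcollection of the blocks of `D` and `D.blocks` is the unique block
collection of a `t-(v,k,λ)` directed design on the same point set
containing `S`. -/
def DirectedDesign.IsDefiningSet {X : Type*} [DecidableEq X] {t k lam : ℕ}
    (D : DirectedDesign X t k lam) (S : Multiset (List X)) : Prop :=
  S ≤ D.blocks ∧
    ∀ D' : DirectedDesign X t k lam, S ≤ D'.blocks → D'.blocks = D.blocks

/-- Every defining set of `D` contains at least half of the blocks
(the paper's condition `d ≥ 1/2`). -/
def DirectedDesign.DefiningHalf {X : Type*} [DecidableEq X] {t k lam : ℕ}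
    (D : DirectedDesign X t k lam) : Prop :=
  ∀ S : Multiset (List X), D.IsDefiningSet S →
    Multiset.card D.blocks ≤ 2 * Multiset.card S

/-- A `(v,k,t)` directed trade `T = T₁ - T₂`: two disjoint nonempty
collections of blocks of the same volume such that every ordered `t`-tuple
of distinct points is covered by equally many blocks of `T₁` as of `T₂`. -/
structure DirectedTrade (X : Type*) [DecidableEq X] (k t : ℕ) where
  pos : Multiset (List X)
  neg : Multiset (List X)
  pos_len : ∀ b ∈ pos, b.length = k
  pos_nodup : ∀ b ∈ pos, b.Nodup
  neg_len : ∀ b ∈ neg, b.length = k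
  neg_nodup : ∀ b ∈ neg, b.Nodup
  disjoint : Disjoint pos neg
  pos_ne : pos ≠ 0
  card_eq : Multiset.card pos = Multiset.card neg
  balanced : ∀ s : List X, s.length = t → s.Nodup →
    pos.countP (fun b => s.Sublist b) = neg.countP (fun b => s.Sublist b)

/-- A `(k,λ)` directed group divisible design (DGDD) with the given group set
`groups`: blocks are ordered `k`-tuples of distinct points meeting each group
in at most one point, and every ordered pair of distinct points from
different groups occurs, in order, in exactly `lam` blocks. -/
structure DGDD (X : Type*) [DecidableEq X] (groups : Finset (Finset X))
    (k lam : ℕ) where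
  blocks : Multiset (List X)
  len : ∀ b ∈ blocks, b.length = k
  nodup : ∀ b ∈ blocks, b.Nodup
  transverse : ∀ b ∈ blocks, ∀ G ∈ groups, (b.toFinset ∩ G).card ≤ 1
  covers : ∀ x y : X, x ≠ y → (∀ G ∈ groups, ¬(x ∈ G ∧ y ∈ G)) →
    blocks.countP (fun b => [x, y].Sublist b) = lam

/-- A DGDD is super-simple if it has no repeated blocks and any two distinct
blocks have at most 2 points in common. -/
def DGDD.SuperSimple {X : Type*} [DecidableEq X] {groups : Finset (Finset X)}
    {k lam : ℕ} (D : DGDD X groups k lam) : Prop :=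
  D.blocks.Nodup ∧
    ∀ b₁ ∈ D.blocks, ∀ b₂ ∈ D.blocks, b₁ ≠ b₂ →
      (b₁.toFinset ∩ b₂.toFinset).card ≤ 2

/-- `S` is a defining set of the DGDD `D` if `S` is a subcollection of the
blocks of `D` and `D.blocks` is the unique block collection of a
`(k,λ)`-DGDD with the same groups containing `S`. -/
def DGDD.IsDefiningSet {X : Type*} [DecidableEq X] {groups : Finset (Finset X)}
    {k lam : ℕ} (D : DGDD X groups k lam) (S : Multiset (List X)) : Prop :=
  S ≤ D.blocks ∧
    ∀ D' : DGDD X groups k lam, S ≤ D'.blocks → D'.blocks = D.blocks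

/-- Every defining set of the DGDD `D` contains at least half of the blocks. -/
def DGDD.DefiningHalf {X : Type*} [DecidableEq X] {groups : Finset (Finset X)}
    {k lam : ℕ} (D : DGDD X groups k lam) : Prop :=
  ∀ S : Multiset (List X), D.IsDefiningSet S →
    Multiset.card D.blocks ≤ 2 * Multiset.card S

/-- A (undirected) `(K,λ)` group divisible design with the given group set
`groups`: blocks are subsets of the point set with sizes in `K` meeting each
group in at most one point, and every pair of distinct points from different
groups lies in exactly `lam` blocks. -/
structure GDD (X : Type*) [DecidableEq X] (groups : Finset (Finset X))
    (K : Finset ℕ) (lam : ℕ) where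
  blocks : Multiset (Finset X)
  size_mem : ∀ b ∈ blocks, b.card ∈ K
  transverse : ∀ b ∈ blocks, ∀ G ∈ groups, (b ∩ G).card ≤ 1
  covers : ∀ x y : X, x ≠ y → (∀ G ∈ groups, ¬(x ∈ G ∧ y ∈ G)) →
    blocks.countP (fun b => x ∈ b ∧ y ∈ b) = lam

/-- `groups` is a partition of the point type `X`: every point lies in
exactly one group. -/
def IsGroupPartition {X : Type*} (groups : Finset (Finset X)) : Prop :=
  ∀ x : X, ∃! G, G ∈ groups ∧ x ∈ G

open scoped Classical in
/-- A decomposition of the (symmetric) relation `adj` into directed blocks of size 4 covering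
every related ordered pair twice, with a trade-matching `τ`. -/
def Good {V : Type} (adj : V → V → Prop) : Prop :=
  ∃ (ι : Type) (_ : Fintype ι) (blk : ι → List V) (τ : ι → ι),
    Function.Injective τ ∧
    (∀ i, (blk i).length = 4) ∧ (∀ i, (blk i).Nodup) ∧
    (∀ x y, (∑ i, if [x, y].Sublist (blk i) then 1 else 0) = if adj x y then 2 else 0) ∧
    (∀ i j x y z, x ≠ y → y ≠ z → x ≠ z → x ∈ blk i → y ∈ blk i → z ∈ blk i →
      x ∈ blk j → y ∈ blk j → z ∈ blk j → i = j) ∧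
    (∀ i, ∃ x y l1 r1 l2 r2, blk i = l1 ++ x :: y :: r1 ∧ blk (τ i) = l2 ++ y :: x :: r2)

theorem adj_of_sum {V ι : Type} [Fintype ι] {blk : ι → List V} {adj : V → V → Prop} 
    {inst : ∀ x y i, Decidable ([x, y].Sublist (blk i))} {inst2 : ∀ x y, Decidable (adj x y)}
    (h : ∀ x y, (∑ i, if [x, y].Sublist (blk i) then 1 else 0) = if adj x y then 2 else 0)
    {x y : V} {i : ι} (hs : [x, y].Sublist (blk i)) : adj x y := by
  by_contra hn
  have := h x y
  rw [if_neg hn, Finset.sum_eq_zero_iff] at this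
  have := this i (Finset.mem_univ _)
  simp [hs] at this

theorem pair_sublist {V : Type} {x y : V} {l : List V} (hx : x ∈ l) (hy : y ∈ l) (hne : x ≠ y) :
    [x, y].Sublist l ∨ [y, x].Sublist l := by
  induction l with
  | nil => simp at hx
  | cons a l ih =>
    rcases List.mem_cons.1 hx with rfl | hx'
    · rcases List.mem_cons.1 hy with rfl | hy'
      · exact absurd rfl hne
      · left; exact List.Sublist.cons_cons _ (List.singleton_sublist.2 hy')
    · rcases List.mem_cons.1 hy with rfl | hy'
      · right; exact List.Sublist.cons_cons _ (List.singleton_sublist.2 hx')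
      · rcases ih hx' hy' with h | h
        · left; exact h.cons _
        · right; exact h.cons _

theorem Good.empty {V : Type} {adj : V → V → Prop} (h : ∀ x y, ¬ adj x y) : Good adj := by
  refine ⟨Empty, inferInstance, fun i => i.elim, id, Function.injective_id, fun i => i.elim,
    fun i => i.elim, fun x y => ?_, fun i => i.elim, fun i => i.elim⟩
  simp [h]

/-- Edge-disjoint unions. -/
theorem Good.union {V K : Type} [Fintype K] {adj : V → V → Prop} (adjk : K → V → V → Prop)
    (hg : ∀ k, Good (adjk k)) (hsymm : ∀ k x y, adjk k x y → adjk k y x)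
    (hsub : ∀ k x y, adjk k x y → adj x y)
    (hex : ∀ x y, adj x y → ∃ k, adjk k x y)
    (huniq : ∀ x y k k', adjk k x y → adjk k' x y → k = k') : Good adj := by
  classical
  choose ι hft blk τ hτ hlen hnd hcov hss htr using hg
  refine ⟨Σ k, ι k, inferInstance, fun p => blk p.1 p.2, fun p => ⟨p.1, τ p.1 p.2⟩, ?_, 
    fun p => hlen _ _, fun p => hnd _ _, ?_, ?_, fun p => htr _ _⟩
  · rintro ⟨k, i⟩ ⟨k', i'⟩ h
    simp only [Sigma.mk.injEq] at h
    obtain ⟨rfl, h⟩ := h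
    rw [hτ _ (eq_of_heq h)]
  · intro x y
    rw [Fintype.sum_sigma]
    have : ∀ k, (∑ i, if [x, y].Sublist (blk k i) then 1 else 0) = if adjk k x y then 2 else 0 := 
      fun k => by convert hcov k x y
    simp only [this]
    by_cases h : adj x y
    · obtain ⟨k, hk⟩ := hex x y h
      rw [if_pos h, Finset.sum_eq_single k, if_pos hk]
      · intro k' _ hne
        rw [if_neg]
        intro h'
        exact hne (huniq x y _ _ h' hk)
      · simp
    · rw [if_neg h]
      apply Finset.sum_eq_zero
      intro k _
      rw [if_neg]
      exact fun h' => h (hsub _ _ _ h')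
  · rintro ⟨k, i⟩ ⟨k', j⟩ x y z hxy hyz hxz hx hy hz hx' hy' hz'
    have key : ∀ k i, x ∈ blk k i → y ∈ blk k i → adjk k x y := by
      intro k i hx hy
      rcases pair_sublist hx hy hxy with h | h
      · exact adj_of_sum (hcov k) h
      · exact hsymm _ _ _ (adj_of_sum (hcov k) h)
    obtain rfl := huniq x y k k' (key _ _ hx hy) (key _ _ hx' hy')
    rw [hss k i j x y z hxy hyz hxz hx hy hz hx' hy' hz']

theorem exists_other {V : Type} {l : List V} (h4 : l.length = 4) (hnd : l.Nodup) {x : V}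
    (hx : x ∈ l) : ∃ y ∈ l, x ≠ y := by
  match l, h4 with
  | [a, b, c, d], _ =>
    by_cases h : x = a
    · refine ⟨b, by simp, ?_⟩
      subst h
      simp at hnd
      tauto
    · exact ⟨a, by simp, h⟩

theorem Good.transport {V W : Type} {adj : V → V → Prop} {adj' : W → W → Prop}
    (hg : Good adj) (f : V → W) (S : Set V) (hf : Set.InjOn f S)
    (hS : ∀ x y, adj x y → x ∈ S ∧ y ∈ S)
    (h1 : ∀ x y, adj x y → adj' (f x) (f y))
    (h2 : ∀ x' y', adj' x' y' → ∃ x y, adj x y ∧ f x = x' ∧ f y = y') : Good adj' := by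
  classical
  obtain ⟨ι, hft, blk, τ, hτ, hlen, hnd, hcov, hss, htr⟩ := hg
  have hbS : ∀ i x, x ∈ blk i → x ∈ S := by
    intro i x hx
    obtain ⟨y, hy, hne⟩ := exists_other (hlen i) (hnd i) hx
    rcases pair_sublist hx hy hne with h | h
    · exact (hS _ _ (adj_of_sum hcov h)).1
    · exact (hS _ _ (adj_of_sum hcov h)).2
  have hsl : ∀ i x' y', [x', y'].Sublist ((blk i).map f) → 
      ∃ x y, [x, y].Sublist (blk i) ∧ f x = x' ∧ f y = y' := by
    intro i x' y' h
    obtain ⟨l, hl, he⟩ := List.sublist_map_iff.1 h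
    match l, he with
    | [x, y], he =>
      simp at he
      exact ⟨x, y, hl, he.1.symm, he.2.symm⟩
  refine ⟨ι, hft, fun i => (blk i).map f, τ, hτ, ?_, ?_, ?_, ?_, ?_⟩
  · intro i; simp [hlen]
  · intro i
    exact List.Nodup.map_on (fun x hx y hy h => hf (hbS i x hx) (hbS i y hy) h) (hnd i)
  · intro x' y'
    by_cases h : adj' x' y'
    · obtain ⟨x, y, ha, rfl, rfl⟩ := h2 _ _ h
      rw [if_pos h]
      have := hcov x y
      rw [if_pos ha] at this
      rw [← this]
      apply Finset.sum_congr rfl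
      intro i _
      congr 1
      apply propext
      constructor
      · intro hs
        obtain ⟨a, b, hab, e1, e2⟩ := hsl _ _ _ hs
        have ha' := hab.subset (a := a) (by simp)
        have hb' := hab.subset (a := b) (by simp)
        have := hf (hbS i _ ha') (hS _ _ ha).1 e1
        have := hf (hbS i _ hb') (hS _ _ ha).2 e2
        subst_vars
        exact hab
      · intro hs
        exact hs.map f
    · rw [if_neg h]
      apply Finset.sum_eq_zero
      intro i _
      rw [if_neg]
      intro hs
      obtain ⟨a, b, hab, rfl, rfl⟩ := hsl _ _ _ hs
      exact h (h1 _ _ (adj_of_sum hcov hab))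
  · intro i j x y z hxy hyz hxz hx hy hz hx' hy' hz'
    obtain ⟨a, ha, rfl⟩ := List.mem_map.1 hx
    obtain ⟨b, hb, rfl⟩ := List.mem_map.1 hy
    obtain ⟨c, hc, rfl⟩ := List.mem_map.1 hz
    have back : ∀ w, w ∈ blk i → f w ∈ (blk j).map f → w ∈ blk j := by
      intro w hw hfw
      obtain ⟨w', hw', e⟩ := List.mem_map.1 hfw
      rwa [← hf (hbS j _ hw') (hbS i _ hw) e]
    exact hss i j a b c (fun h => hxy (by rw [h])) (fun h => hyz (by rw [h]))
      (fun h => hxz (by rw [h])) ha hb hc (back _ ha hx') (back _ hb hy') (back _ hc hz')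
  · intro i
    obtain ⟨x, y, l1, r1, l2, r2, e1, e2⟩ := htr i
    exact ⟨f x, f y, l1.map f, r1.map f, l2.map f, r2.map f, by simp [e1], by simp [e2]⟩

theorem pair_sublist_cons {V : Type} {u w a : V} {l : List V} :
    [u, w].Sublist (a :: l) ↔ [u, w].Sublist l ∨ (u = a ∧ w ∈ l) := by
  rw [List.cons_sublist_cons']
  simp [List.singleton_sublist]

theorem swap_sublist {V : Type} {x y u w : V} (l r : List V) (h1 : ¬ (u = x ∧ w = y))
    (h2 : ¬ (u = y ∧ w = x)) :
    [u, w].Sublist (l ++ x :: y :: r) ↔ [u, w].Sublist (l ++ y :: x :: r) := by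
  induction l with
  | nil => simp only [List.nil_append, pair_sublist_cons, List.mem_cons]; tauto
  | cons a l ih =>
    simp only [List.cons_append, pair_sublist_cons, ih, List.mem_append, List.mem_cons]
    tauto

theorem xy_sublist {V : Type} {x y : V} (l r : List V) : [x, y].Sublist (l ++ x :: y :: r) := by
  induction l with
  | nil => simp
  | cons a l ih => simp only [List.cons_append, pair_sublist_cons, ih, true_or]

theorem yx_not_sublist {V : Type} {x y : V} (l r : List V) (hnd : (l ++ x :: y :: r).Nodup) :
    ¬ [y, x].Sublist (l ++ x :: y :: r) := by
  induction l with
  | nil =>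
    simp only [List.nil_append, pair_sublist_cons]
    simp at hnd
    rintro ((h | h) | h)
    · exact hnd.1.2 (h.subset (by simp))
    · exact hnd.1.2 h.2
    · exact hnd.1.1 h.1.symm
  | cons a l ih =>
    simp only [List.cons_append, pair_sublist_cons]
    rw [List.cons_append, List.nodup_cons] at hnd
    rintro (h | h)
    · exact ih hnd.2 h
    · apply hnd.1; rw [← h.1]; simp

theorem swap_nodup {V : Type} {x y : V} {l r : List V} (hnd : (l ++ x :: y :: r).Nodup) :
    (l ++ y :: x :: r).Nodup := by
  refine (List.Perm.nodup_iff ?_).1 hnd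
  exact List.Perm.append_left _ (List.Perm.swap _ _ _)

theorem inter_le_two {V : Type} [DecidableEq V] {l l' : List V}
    (h : ∀ x y z, x ≠ y → y ≠ z → x ≠ z → x ∈ l → y ∈ l → z ∈ l →
      x ∈ l' → y ∈ l' → z ∈ l' → False) : (l.toFinset ∩ l'.toFinset).card ≤ 2 := by
  by_contra hc
  push Not at hc
  obtain ⟨x, y, z, hx, hy, hz, hxy, hxz, hyz⟩ := Finset.two_lt_card_iff.1 hc
  simp only [Finset.mem_inter, List.mem_toFinset] at hx hy hz
  exact h x y z hxy hyz hxz hx.1 hy.1 hz.1 hx.2 hy.2 hz.2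

theorem three_mem {V : Type} {l : List V} (h4 : l.length = 4) (hnd : l.Nodup) :
    ∃ x y z, x ≠ y ∧ y ≠ z ∧ x ≠ z ∧ x ∈ l ∧ y ∈ l ∧ z ∈ l := by
  match l, h4 with
  | [a, b, c, d], _ =>
    simp at hnd
    exact ⟨a, b, c, by tauto, by tauto, by tauto, by simp, by simp, by simp⟩

theorem ind_swap {V : Type} {x y u w : V} {l1 r1 l2 r2 : List V} (hne : x ≠ y)
    (n1 : (l1 ++ x :: y :: r1).Nodup) (n2 : (l2 ++ y :: x :: r2).Nodup)
    {inst : ∀ l, Decidable ([u, w].Sublist l)} :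
    ((if [u, w].Sublist (l1 ++ y :: x :: r1) then 1 else 0) +
      (if [u, w].Sublist (l2 ++ x :: y :: r2) then 1 else 0) : ℕ) =
    (if [u, w].Sublist (l1 ++ x :: y :: r1) then 1 else 0) +
      (if [u, w].Sublist (l2 ++ y :: x :: r2) then 1 else 0) := by
  by_cases h1 : u = x ∧ w = y
  · obtain ⟨rfl, rfl⟩ := h1
    rw [if_neg (yx_not_sublist _ _ (swap_nodup n1)), if_pos (xy_sublist _ _), 
      if_pos (xy_sublist _ _), if_neg (yx_not_sublist _ _ n2)]
  · by_cases h2 : u = y ∧ w = x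
    · obtain ⟨rfl, rfl⟩ := h2
      rw [if_pos (xy_sublist _ _), if_neg (yx_not_sublist _ _ (swap_nodup n2)),
        if_neg (yx_not_sublist _ _ n1), if_pos (xy_sublist _ _)]
    · simp only [swap_sublist l1 r1 h1 h2, swap_sublist l2 r2 h2 h1]

theorem Good.design {v : ℕ} (hg : Good (fun x y : Fin v => x ≠ y)) :
    ∃ D : DirectedDesign (Fin v) 2 4 2, D.SuperSimple ∧ D.DefiningHalf := by
  classical
  obtain ⟨ι, hft, blk, τ, hτ, hlen, hnd, hcov, hss, htr⟩ := hg
  -- designs from block functions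
  have mk : ∀ f : ι → List (Fin v), (∀ i, (f i).length = 4) → (∀ i, (f i).Nodup) →
      (∀ x y, (∑ i, if [x, y].Sublist (f i) then 1 else 0) = if x ≠ y then 2 else 0) →
      ∃ D : DirectedDesign (Fin v) 2 4 2, D.blocks = Finset.univ.val.map f := by
    intro f h1 h2 h3
    refine ⟨⟨Finset.univ.val.map f, ?_, ?_, ?_⟩, rfl⟩
    · intro b hb
      obtain ⟨i, _, rfl⟩ := Multiset.mem_map.1 hb
      exact h1 i
    · intro b hb
      obtain ⟨i, _, rfl⟩ := Multiset.mem_map.1 hb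
      exact h2 i
    · intro s hs hsn
      match s, hs with
      | [x, y], _ =>
        have hxy : x ≠ y := by simpa using hsn
        have := h3 x y
        rw [if_pos hxy, Finset.sum_boole] at this
        rw [Multiset.countP_map]
        simpa [Finset.card_def, Finset.filter_val] using this
  have hinj : Function.Injective blk := by
    intro i j h
    obtain ⟨x, y, z, h1, h2, h3, hx, hy, hz⟩ := three_mem (hlen i) (hnd i)
    exact hss i j x y z h1 h2 h3 hx hy hz (h ▸ hx) (h ▸ hy) (h ▸ hz)
  obtain ⟨D, hD⟩ := mk blk hlen hnd (fun x y => by convert hcov x y)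
  have hDn : D.blocks.Nodup := by
    rw [hD]; exact Multiset.Nodup.map hinj Finset.univ.nodup
  refine ⟨D, ⟨hDn, ?_⟩, ?_⟩
  · intro b₁ h₁ b₂ h₂ hne
    rw [hD] at h₁ h₂
    obtain ⟨i, _, rfl⟩ := Multiset.mem_map.1 h₁
    obtain ⟨j, _, rfl⟩ := Multiset.mem_map.1 h₂
    apply inter_le_two
    intro x y z a b c d e f g h k
    exact hne (by rw [hss i j x y z a b c d e f g h k])
  · rintro S ⟨hS, hdef⟩
    have key : ∀ i, blk i ∈ S ∨ blk (τ i) ∈ S := by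
      intro i
      by_contra hcon
      push Not at hcon
      obtain ⟨hi, hti⟩ := hcon
      obtain ⟨x, y, l1, r1, l2, r2, e1, e2⟩ := htr i
      have n1 := hnd i
      have n2 := hnd (τ i)
      have k1 := hlen i
      have k2 := hlen (τ i)
      rw [e1] at n1 k1
      rw [e2] at n2 k2
      have hxy : x ≠ y := by
        rintro rfl
        simp [List.nodup_append] at n1
      have hit : i ≠ τ i := by
        intro h
        have : [x, y].Sublist (blk (τ i)) := by rw [← h, e1]; exact xy_sublist _ _
        rw [e2] at this
        exact yx_not_sublist _ _ n2 this
      let f : ι → List (Fin v) := fun j => if j = i then l1 ++ y :: x :: r1 else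
        if j = τ i then l2 ++ x :: y :: r2 else blk j
      have fi : f i = l1 ++ y :: x :: r1 := by simp [f]
      have ft : f (τ i) = l2 ++ x :: y :: r2 := by simp [f, hit.symm]
      have fo : ∀ j, j ≠ i → j ≠ τ i → f j = blk j := fun j h h' => by simp [f, h, h']
      have all : ∀ P : List (Fin v) → Prop, P (f i) → P (f (τ i)) → (∀ j, P (blk j)) → 
          ∀ j, P (f j) := by
        intro P h1 h2 h3 j
        by_cases hj : j = i
        · rw [hj]; exact h1
        · by_cases hj' : j = τ i
          · rw [hj']; exact h2
          · rw [fo j hj hj']; exact h3 j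
      obtain ⟨D', hD'⟩ := mk f
        (all (fun l => l.length = 4) (by rw [fi]; simpa using k1) (by rw [ft]; simpa using k2) hlen)
        (all (fun l => l.Nodup) (by rw [fi]; exact swap_nodup n1)
          (by rw [ft]; exact swap_nodup n2) hnd)
        (by
          intro u w
          have := hcov u w
          have h' : (∑ j, if [u, w].Sublist (blk j) then 1 else 0) = if u ≠ w then 2 else 0 := by
            convert this
          rw [← h']
          rw [← Finset.add_sum_erase _ _ (Finset.mem_univ i),
            ← Finset.add_sum_erase Finset.univ (fun j => if [u, w].Sublist (blk j) then 1 else 0)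
              (Finset.mem_univ i)]
          have hm : τ i ∈ Finset.univ.erase i := by simp [hit.symm]
          rw [← Finset.add_sum_erase _ _ hm,
            ← Finset.add_sum_erase _ (fun j => if [u, w].Sublist (blk j) then 1 else 0) hm]
          rw [← add_assoc, ← add_assoc]
          congr 1
          · rw [fi, ft, e1, e2]
            exact ind_swap hxy n1 n2
          · apply Finset.sum_congr rfl
            intro j hj
            simp at hj
            rw [fo j hj.2 hj.1])
      have hSD' : S ≤ D'.blocks := by
        rw [Multiset.le_iff_subset (Multiset.nodup_of_le hS hDn)]
        intro b hb
        have hb' := Multiset.mem_of_le hS hb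
        rw [hD] at hb'
        obtain ⟨j, _, rfl⟩ := Multiset.mem_map.1 hb'
        rw [hD']
        refine Multiset.mem_map.2 ⟨j, by simp, fo j ?_ ?_⟩
        · rintro rfl; exact hi hb
        · rintro rfl; exact hti hb
      have heq := hdef D' hSD'
      have hm : f i ∈ D.blocks := by
        rw [← heq, hD']; exact Multiset.mem_map.2 ⟨i, by simp, rfl⟩
      rw [hD] at hm
      obtain ⟨j, _, hj⟩ := Multiset.mem_map.1 hm
      obtain ⟨a, b, c, h1, h2, h3, ha, hb, hc⟩ := three_mem (hlen i) (hnd i)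
      have tr : ∀ z, z ∈ blk i → z ∈ blk j := by
        intro z hz
        rw [hj, fi]
        rw [e1] at hz
        simp at hz ⊢
        tauto
      have := hss i j a b c h1 h2 h3 ha hb hc (tr _ ha) (tr _ hb) (tr _ hc)
      subst this
      rw [fi] at hj
      apply yx_not_sublist _ _ n1
      rw [← e1, hj]
      exact xy_sublist _ _
    let T : Finset ι := Finset.univ.filter (fun i => blk i ∈ S)
    have hT : T.card ≤ Multiset.card S := by
      have : T.val.map blk ≤ S := by
        rw [Multiset.le_iff_subset (Multiset.Nodup.map hinj T.nodup)]
        intro b hb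
        obtain ⟨j, hj, rfl⟩ := Multiset.mem_map.1 hb
        simpa [T] using hj
      simpa using Multiset.card_le_card this
    have hTc : Tᶜ.card ≤ T.card := by
      apply Finset.card_le_card_of_injOn τ
      · intro i hi
        have := key i
        simp [T] at hi ⊢
        tauto
      · exact hτ.injOn
    have := Finset.card_add_card_compl T
    rw [hD, Multiset.card_map]
    change Finset.univ.card ≤ _
    rw [Finset.card_univ]
    omega

/-- The difference `b - a` modulo `m`. -/
def dN (m a b : ℕ) : ℕ := (b + (m - a)) % m

/-- A base block (first four entries) and the index of the block it is matched with. -/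
abbrev BB := ℕ × ℕ × ℕ × ℕ × ℕ

def pts : BB → List ℕ
  | (a, b, c, d, _) => [a, b, c, d]

def tgt : BB → ℕ
  | (_, _, _, _, j) => j

def diffs (m : ℕ) : BB → List ℕ
  | (a, b, c, d, _) => [dN m a b, dN m a c, dN m a d, dN m b c, dN m b d, dN m c d]

def fwd (m : ℕ) : BB → List ℕ
  | (a, b, c, d, _) => [dN m a b, dN m b c, dN m c d]

def bwd (m : ℕ) : BB → List ℕ
  | (a, b, c, d, _) => [dN m b a, dN m c b, dN m d c]

def trips : BB → List (ℕ × ℕ × ℕ)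
  | (a, b, c, d, _) =>
    [(a, b, c), (a, b, d), (a, c, b), (a, c, d), (a, d, b), (a, d, c),
     (b, a, c), (b, a, d), (b, c, a), (b, c, d), (b, d, a), (b, d, c),
     (c, a, b), (c, a, d), (c, b, a), (c, b, d), (c, d, a), (c, d, b),
     (d, a, b), (d, a, c), (d, b, a), (d, b, c), (d, c, a), (d, c, b)]

def code (m : ℕ) : ℕ × ℕ × ℕ → ℕ
  | (p, q, r) => dN m p q * m + dN m p r

/-- Duplicate-freeness with the set of seen numbers stored in a bit mask. -/
def nodupB : ℕ → List ℕ → Bool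
  | _, [] => true
  | acc, x :: xs => !(acc.testBit x) && nodupB (acc ||| (1 <<< x)) xs

theorem nodupB_spec (l : List ℕ) : ∀ acc, nodupB acc l = true → 
    (∀ x ∈ l, acc.testBit x = false) ∧ l.Nodup := by
  induction l with
  | nil => intro acc _; simp
  | cons a l ih =>
    intro acc h
    simp only [nodupB, Bool.and_eq_true, Bool.not_eq_true'] at h
    obtain ⟨h1, h2⟩ := ih _ h.2
    have h3 : ∀ x ∈ l, acc.testBit x = false ∧ x ≠ a := by
      intro x hx
      have := h1 x hx
      rw [Nat.testBit_or, Bool.or_eq_false_iff] at this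
      refine ⟨this.1, ?_⟩
      rintro rfl
      have h5 := this.2
      simp [Nat.testBit_shiftLeft] at h5
    refine ⟨?_, ?_⟩
    · intro x hx
      rcases List.mem_cons.1 hx with rfl | hx
      · exact h.1
      · exact (h3 x hx).1
    · rw [List.nodup_cons]
      exact ⟨fun ha => (h3 a ha).2 rfl, h2⟩

/-- Checks that no number occurs more than twice, with two bit masks. -/
def twiceB : ℕ → ℕ → List ℕ → Bool
  | _, _, [] => true
  | a, b, x :: xs => 
    match a.testBit x with
    | true => !(b.testBit x) && twiceB a (b ||| (1 <<< x)) xs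
    | false => twiceB (a ||| (1 <<< x)) b xs

theorem testBit_ins (a x d : ℕ) : (a ||| (1 <<< x)).testBit d = (a.testBit d || decide (d = x)) := by
  rw [Nat.testBit_or, Nat.one_shiftLeft, Nat.testBit_two_pow]
  congr 1
  simp [eq_comm]

theorem twiceB_spec (l : List ℕ) : ∀ a b, twiceB a b l = true → ∀ d,
    (a.testBit d = true → b.testBit d = true → l.count d = 0) ∧
    (a.testBit d = true → l.count d ≤ 1) ∧ l.count d ≤ 2 := by
  induction l with
  | nil => intro a b _ d; simp
  | cons x l ih =>
    intro a b h d
    unfold twiceB at h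
    rw [List.count_cons]
    rcases hax : a.testBit x with _ | _
    · rw [hax] at h
      have := ih _ _ h d
      rw [testBit_ins] at this
      by_cases hd : x = d
      · subst hd
        simp [hax] at this ⊢
        omega
      · simpa [hd, Ne.symm hd] using this
    · rw [hax] at h
      simp only [Bool.and_eq_true, Bool.not_eq_true'] at h
      have := ih _ _ h.2 d
      rw [testBit_ins] at this
      by_cases hd : x = d
      · subst hd
        simp [hax, h.1] at this ⊢
        omega
      · simpa [hd, Ne.symm hd] using this

theorem count_two {m k : ℕ} {l : List ℕ} (h1 : ∀ d, l.count d ≤ 2) 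
    (h2 : ∀ d ∈ l, d < m ∧ d % k ≠ 0)
    (h3 : l.length = 2 * ((List.range m).filter fun d => d % k ≠ 0).length) (d : ℕ) (hd : d < m) :
    l.count d = if d % k = 0 then 0 else 2 := by
  by_cases h : d % k = 0
  · rw [if_pos h, List.count_eq_zero]
    exact fun hm => (h2 d hm).2 h
  · rw [if_neg h]
    let F := (Finset.range m).filter fun d => d % k ≠ 0
    have e1 : ∑ a ∈ F, (l : Multiset ℕ).count a = Multiset.card (l : Multiset ℕ) :=
      Multiset.sum_count_eq_card (fun a ha => by simpa [F] using h2 a (by simpa using ha))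
    have e2 : ((List.range m).filter fun d => d % k ≠ 0).length = F.card := by
      simp [F, Finset.card_def, Finset.filter_val, Finset.range_val, Multiset.range]
    have e3 : ∑ a ∈ F, (l : Multiset ℕ).count a = ∑ a ∈ F, 2 := by
      rw [e1, Finset.sum_const, ← e2, Multiset.coe_card, h3, smul_eq_mul, mul_comm]
    have := (Finset.sum_eq_sum_iff_of_le (fun a _ => by simpa using h1 a)).1 e3 d
      (by simp [F, hd, h])
    simpa using this

def check (m k : ℕ) (L : List BB) : Bool :=
  (L.all fun B => (pts B).all fun a => decide (a < m)) &&
  twiceB 0 0 (L.flatMap (diffs m)) &&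
  ((L.flatMap (diffs m)).all fun d => decide (d < m ∧ d % k ≠ 0)) &&
  ((L.flatMap (diffs m)).length == 2 * ((List.range m).filter fun d => d % k ≠ 0).length) &&
  nodupB 0 (L.flatMap fun B => (trips B).map (code m)) &&
  nodupB 0 (L.map tgt) &&
  (L.all fun B => match L[tgt B]? with
    | none => false
    | some C => (fwd m B).any fun d => (bwd m C).any fun e => d == e)

theorem dN_cast {m a b : ℕ} (ha : a < m) : ((dN m a b : ℕ) : ZMod m) = (b : ZMod m) - a := by
  unfold dN
  rw [ZMod.natCast_mod, Nat.cast_add, Nat.cast_sub ha.le]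
  simp
  ring

theorem dN_lt {m a b : ℕ} (ha : a < m) : dN m a b < m := Nat.mod_lt _ (by omega)

theorem dN_eq_iff {m a b : ℕ} [NeZero m] (ha : a < m) (z : ZMod m) :
    dN m a b = z.val ↔ (b : ZMod m) - a = z := by
  rw [← dN_cast ha]
  constructor
  · intro h; rw [h]; simp
  · rintro rfl
    rw [ZMod.val_natCast, Nat.mod_eq_of_lt (dN_lt ha)]

theorem zcast_inj {m a b : ℕ} (ha : a < m) (hb : b < m) (h : (a : ZMod m) = b) : a = b := by
  rw [ZMod.natCast_eq_natCast_iff'] at h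
  rwa [Nat.mod_eq_of_lt ha, Nat.mod_eq_of_lt hb] at h

theorem ind_four {V : Type} {a b c d : V} (h : [a, b, c, d].Nodup) (x y : V)
    {inst : Decidable ([x, y].Sublist [a, b, c, d])} [DecidableEq V] :
    (if [x, y].Sublist [a, b, c, d] then 1 else 0 : ℕ) =
      (if x = a ∧ y = b then 1 else 0) + (if x = a ∧ y = c then 1 else 0) +
      (if x = a ∧ y = d then 1 else 0) + (if x = b ∧ y = c then 1 else 0) +
      (if x = b ∧ y = d then 1 else 0) + (if x = c ∧ y = d then 1 else 0) := by
  have e : [x, y].Sublist [a, b, c, d] ↔ (x = a ∧ y = b) ∨ (x = a ∧ y = c) ∨ (x = a ∧ y = d) ∨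
      (x = b ∧ y = c) ∨ (x = b ∧ y = d) ∨ (x = c ∧ y = d) := by
    simp only [pair_sublist_cons]
    simp
    tauto
  simp only [e]
  simp at h
  by_cases h1 : x = a
  · subst h1
    by_cases h2 : y = b
    · subst h2; simp; grind
    · by_cases h3 : y = c
      · subst h3; simp; grind
      · grind
  · grind

theorem sum_shift {m : ℕ} [NeZero m] {a b : ℕ} (ha : a < m) (x y : ZMod m) :
    (∑ g : ZMod m, if x = (a : ZMod m) + g ∧ y = (b : ZMod m) + g then 1 else 0 : ℕ) =
      if dN m a b = (y - x).val then 1 else 0 := by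
  rw [Finset.sum_eq_single (x - a)]
  · congr 1
    apply propext
    rw [dN_eq_iff ha]
    constructor
    · rintro ⟨_, h⟩; rw [h]; ring
    · intro h; refine ⟨by ring, ?_⟩; linear_combination -h
  · intro g _ hg
    rw [if_neg]
    rintro ⟨h, _⟩
    exact hg (by rw [h]; ring)
  · simp

theorem trips_mem {B : BB} {p q r : ℕ} (hp : p ∈ pts B) (hq : q ∈ pts B) (hr : r ∈ pts B)
    (h1 : p ≠ q) (h2 : q ≠ r) (h3 : p ≠ r) : (p, q, r) ∈ trips B := by
  obtain ⟨a, b, c, d, j⟩ := B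
  simp only [pts, List.mem_cons, List.not_mem_nil, or_false] at hp hq hr
  rcases hp with rfl | rfl | rfl | rfl <;> rcases hq with rfl | rfl | rfl | rfl <;>
    rcases hr with rfl | rfl | rfl | rfl <;> first | contradiction | simp [trips]

theorem fwd_mem {m : ℕ} {B : BB} {e : ℕ} (h : e ∈ fwd m B) :
    ∃ x y l r, pts B = l ++ x :: y :: r ∧ e = dN m x y := by
  obtain ⟨a, b, c, d, j⟩ := B
  simp only [fwd, List.mem_cons, List.not_mem_nil, or_false] at h
  rcases h with rfl | rfl | rfl
  · exact ⟨a, b, [], [c, d], rfl, rfl⟩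
  · exact ⟨b, c, [a], [d], rfl, rfl⟩
  · exact ⟨c, d, [a, b], [], rfl, rfl⟩

theorem bwd_mem {m : ℕ} {B : BB} {e : ℕ} (h : e ∈ bwd m B) :
    ∃ x y l r, pts B = l ++ y :: x :: r ∧ e = dN m x y := by
  obtain ⟨a, b, c, d, j⟩ := B
  simp only [bwd, List.mem_cons, List.not_mem_nil, or_false] at h
  rcases h with rfl | rfl | rfl
  · exact ⟨b, a, [], [c, d], rfl, rfl⟩
  · exact ⟨c, b, [a], [d], rfl, rfl⟩
  · exact ⟨d, c, [a, b], [], rfl, rfl⟩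

/-- Translate of a base block. -/
def tr (m : ℕ) (B : BB) (g : ZMod m) : List (ZMod m) := (pts B).map fun a : ℕ => (a : ZMod m) + g

theorem sum_block {m : ℕ} [NeZero m] (B : BB) (hB : ∀ a ∈ pts B, a < m)
    (hnd : ∀ g, (tr m B g).Nodup) (x y : ZMod m)
    {inst : ∀ l, Decidable ([x, y].Sublist l)} :
    (∑ g : ZMod m, if [x, y].Sublist (tr m B g) then 1 else 0 : ℕ) =
      (diffs m B).count (y - x).val := by
  obtain ⟨a, b, c, d, j⟩ := B
  simp only [pts, List.mem_cons, List.not_mem_nil, or_false, forall_eq_or_imp, forall_eq] at hB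
  obtain ⟨ha, hb, hc, hd⟩ := hB
  have : ∀ g, (if [x, y].Sublist (tr m (a, b, c, d, j) g) then 1 else 0 : ℕ) = _ := 
    fun g => ind_four (hnd g) x y
  simp only [this, Finset.sum_add_distrib]
  rw [sum_shift ha, sum_shift ha, sum_shift ha, sum_shift hb, sum_shift hb, sum_shift hc]
  simp only [diffs, List.count_cons, List.count_nil, beq_iff_eq]
  ring

theorem sum_count_flatMap (L : List BB) (f : BB → List ℕ) (z : ℕ) :
    (∑ i : Fin L.length, (f (L.get i)).count z) = (L.flatMap f).count z := by
  rw [List.count_flatMap, ← List.sum_ofFn]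
  congr 1
  conv_rhs => rw [← List.ofFn_get L, List.map_ofFn]
  rfl

theorem check_good {m k : ℕ} [NeZero m] {L : List BB} (h : check m k L = true) :
    Good (fun x y : ZMod m => ¬ (y - x).val % k = 0) := by
  classical
  simp only [check, Bool.and_eq_true, List.all_eq_true, decide_eq_true_eq, beq_iff_eq] at h
  obtain ⟨⟨⟨⟨⟨⟨h1, u1⟩, u2⟩, u3⟩, h3⟩, h4⟩, h5⟩ := h
  have h2 := count_two (fun d => (twiceB_spec _ _ _ u1 d).2.2) u2 u3
  have h3' := (nodupB_spec _ _ h3).2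
  have h4' := (nodupB_spec _ _ h4).2
  rw [List.nodup_flatMap] at h3'
  obtain ⟨c1, c2⟩ := h3'
  have hlt : ∀ i : Fin L.length, ∀ a ∈ pts (L.get i), a < m := fun i => h1 _ (List.get_mem _ _)
  have hpn : ∀ B ∈ L, (pts B).Nodup := by
    rintro ⟨a, b, c, d, j⟩ hB
    have z := c1 _ hB
    have hm := h1 _ hB
    simp only [pts, List.mem_cons, List.not_mem_nil, or_false, forall_eq_or_imp, forall_eq] at hm
    have hz : ∀ d', d' ∈ diffs m (a, b, c, d, j) → d' ≠ 0 := by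
      rintro d' hd' rfl
      have := h2 0 (by omega)
      simp only [Nat.zero_mod, if_true, List.count_eq_zero] at this
      exact this (List.mem_flatMap.2 ⟨_, hB, hd'⟩)
    have hd0 : ∀ a, a < m → dN m a a = 0 := by
      intro a ha; unfold dN; rw [Nat.add_sub_cancel' ha.le, Nat.mod_self]
    simp only [diffs, List.mem_cons, List.not_mem_nil, or_false, forall_eq_or_imp, forall_eq] at hz
    obtain ⟨ha, hb, hc, hd⟩ := hm
    obtain ⟨q1, q2, q3, q4, q5, q6⟩ := hz
    have e1 : a ≠ b := by rintro rfl; exact q1 (hd0 _ ha)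
    have e2 : a ≠ c := by rintro rfl; exact q2 (hd0 _ ha)
    have e3 : a ≠ d := by rintro rfl; exact q3 (hd0 _ ha)
    have e4 : b ≠ c := by rintro rfl; exact q4 (hd0 _ hb)
    have e5 : b ≠ d := by rintro rfl; exact q5 (hd0 _ hb)
    have e6 : c ≠ d := by rintro rfl; exact q6 (hd0 _ hc)
    simp [pts, e1, e2, e3, e4, e5, e6]
  have hnd : ∀ (i : Fin L.length) g, (tr m (L.get i) g).Nodup := by
    intro i g
    refine List.Nodup.map_on ?_ (hpn _ (List.get_mem _ _))
    intro x hx y hy hxy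
    exact zcast_inj (hlt i x hx) (hlt i y hy) (add_right_cancel hxy)
  -- the matching
  have hmatch : ∀ i : Fin L.length, ∃ j : Fin L.length, j.val = tgt (L.get i) ∧ ∃ t : ZMod m,
      ∀ g, ∃ x y l1 r1 l2 r2, tr m (L.get i) g = l1 ++ x :: y :: r1 ∧ 
        tr m (L.get j) (g + t) = l2 ++ y :: x :: r2 := by
    intro i
    have := h5 _ (List.get_mem L i)
    rcases hq : L[tgt (L.get i)]? with _ | C
    · rw [hq] at this; simp at this
    · rw [hq] at this
      obtain ⟨hl, hC⟩ := List.getElem?_eq_some_iff.1 hq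
      simp only [List.any_eq_true, beq_iff_eq] at this
      obtain ⟨d, hd, e, he, hde⟩ := this
      refine ⟨⟨_, hl⟩, rfl, ?_⟩
      have hj : L.get ⟨tgt (L.get i), hl⟩ = C := hC
      rw [hj]
      have hCm : ∀ a ∈ pts C, a < m := by rw [← hj]; exact hlt _
      obtain ⟨x, y, l1, r1, e1, f1⟩ := fwd_mem hd
      obtain ⟨x', y', l2, r2, e2, f2⟩ := bwd_mem he
      have hx := hlt i x (by rw [e1]; simp)
      have hx' := hCm x' (by rw [e2]; simp)
      have key : (y : ZMod m) - x = y' - x' := by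
        rw [← dN_cast hx, ← dN_cast hx', ← f1, ← f2, hde]
      refine ⟨(y : ZMod m) - y', fun g => ⟨x + g, y + g, l1.map (fun a : ℕ => (a : ZMod m) + g),
        r1.map (fun a : ℕ => (a : ZMod m) + g), l2.map (fun a : ℕ => (a : ZMod m) + (g + (y - y'))), 
        r2.map (fun a : ℕ => (a : ZMod m) + (g + (y - y'))), ?_, ?_⟩⟩
      · unfold tr; rw [e1]; simp
      · unfold tr; rw [e2]
        rw [List.map_append, List.map_cons, List.map_cons]
        congr 2
        · ring
        · congr 1
          linear_combination key
  choose σ hσ t ht using hmatch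
  have hσi : Function.Injective σ := by
    intro i j hij
    have h6 : tgt (L.get i) = tgt (L.get j) := by rw [← hσ, ← hσ, hij]
    have hi : i.val < (L.map tgt).length := by simp
    have hj : j.val < (L.map tgt).length := by simp
    have := (List.Nodup.getElem_inj_iff h4' (hi := hi) (hj := hj)).1 (by simpa using h6)
    exact Fin.ext this
  refine ⟨Fin L.length × ZMod m, inferInstance, fun p => tr m (L.get p.1) p.2,
    fun p => (σ p.1, p.2 + t p.1), ?_, ?_, fun p => hnd _ _, ?_, ?_, fun p => ht p.1 p.2⟩
  · rintro ⟨i, g⟩ ⟨j, g'⟩ hh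
    simp only [Prod.mk.injEq] at hh
    obtain ⟨ha, hb⟩ := hh
    obtain rfl := hσi ha
    rw [add_right_cancel hb]
  · rintro ⟨i, g⟩
    show (tr m (L.get i) g).length = 4; unfold tr; rw [List.length_map]
    rfl
  · intro x y
    rw [Fintype.sum_prod_type]
    refine (Finset.sum_congr rfl fun i _ => sum_block _ (hlt i) (hnd i) x y).trans ?_
    rw [sum_count_flatMap, h2 _ (ZMod.val_lt _)]
    by_cases hz : (y - x).val % k = 0 <;> simp [hz]
  · rintro ⟨i, g⟩ ⟨j, g'⟩ x y z hxy hyz hxz hx hy hz hx' hy' hz'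
    change _ ∈ tr m (L.get i) g at hx hy hz
    change _ ∈ tr m (L.get j) g' at hx' hy' hz'
    unfold tr at hx hy hz hx' hy' hz'
    obtain ⟨p, hp, rfl⟩ := List.mem_map.1 hx
    obtain ⟨q, hq, rfl⟩ := List.mem_map.1 hy
    obtain ⟨r, hr, rfl⟩ := List.mem_map.1 hz
    obtain ⟨p', hp', ep⟩ := List.mem_map.1 hx'
    obtain ⟨q', hq', eq⟩ := List.mem_map.1 hy'
    obtain ⟨r', hr', er⟩ := List.mem_map.1 hz'
    have n1 : p ≠ q := by rintro rfl; exact hxy rfl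
    have n2 : q ≠ r := by rintro rfl; exact hyz rfl
    have n3 : p ≠ r := by rintro rfl; exact hxz rfl
    have m1 : p' ≠ q' := by rintro rfl; exact hxy (by rw [← ep, ← eq])
    have m2 : q' ≠ r' := by rintro rfl; exact hyz (by rw [← er, ← eq])
    have m3 : p' ≠ r' := by rintro rfl; exact hxz (by rw [← er, ← ep])
    have T1 := trips_mem hp hq hr n1 n2 n3
    have T2 := trips_mem hp' hq' hr' m1 m2 m3
    have dd : ∀ a b a' b' : ℕ, a < m → a' < m → (b : ZMod m) - a = b' - a' → 
        dN m a b = dN m a' b' := by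
      intro a b a' b' ha ha' hh
      rw [← dN_cast ha, ← dN_cast ha'] at hh
      exact zcast_inj (dN_lt ha) (dN_lt ha') hh
    have hc : code m (p, q, r) = code m (p', q', r') := by
      simp only [code]
      rw [dd p q p' q' (hlt _ _ hp) (hlt _ _ hp') (by linear_combination ep - eq),
        dd p r p' r' (hlt _ _ hp) (hlt _ _ hp') (by linear_combination ep - er)]
    have hij : i = j := by
      by_contra hne
      have hdisj : ∀ i j : Fin L.length, i < j → 
          List.Disjoint ((trips (L.get i)).map (code m)) ((trips (L.get j)).map (code m)) := by
        intro i j hlt'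
        exact List.pairwise_iff_get.1 c2 i j hlt'
      rcases lt_or_gt_of_ne hne with hl | hl
      · exact hdisj i j hl (List.mem_map_of_mem T1) (hc ▸ List.mem_map_of_mem T2)
      · exact hdisj j i hl (List.mem_map_of_mem T2) (hc ▸ List.mem_map_of_mem T1)
    subst hij
    have := List.inj_on_of_nodup_map (c1 _ (List.get_mem L i)) T1 T2 hc
    simp only [Prod.mk.injEq] at this
    obtain ⟨rfl, _, _⟩ := this
    rw [add_left_cancel ep]

def gdd6 : List BB :=
  [(0, 10, 17, 1, 2), (0, 4, 17, 13, 4), (0, 8, 5, 16, 3), (0, 2, 5, 3, 0), (0, 15, 7, 11, 1)]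

theorem gdd6_ok : check 18 6 gdd6 = true := by decide +kernel

def gdd7 : List BB :=
  [(0, 9, 11, 15, 3), (0, 13, 12, 8, 4), (0, 9, 5, 6, 0), (0, 16, 5, 3, 5), (0, 15, 19, 18, 2),
   (0, 1, 11, 13, 1)]

theorem gdd7_ok : check 21 7 gdd7 = true := by decide +kernel

def gdd8 : List BB :=
  [(0, 21, 4, 17, 2), (0, 5, 7, 6, 6), (0, 9, 11, 14, 0), (0, 20, 15, 18, 5), (0, 23, 9, 21, 4),
   (0, 1, 11, 15, 3), (0, 18, 13, 6, 1)]

theorem gdd8_ok : check 24 8 gdd8 = true := by decide +kernel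

def des3 : List BB :=
  [(0, 5, 9, 1, 1), (0, 8, 1, 7, 2), (0, 4, 7, 2, 0)]

theorem des3_ok : check 10 10 des3 = true := by decide +kernel

def des4 : List BB :=
  [(0, 1, 7, 5, 2), (0, 1, 9, 6, 3), (0, 10, 9, 12, 0), (0, 4, 7, 2, 1)]

theorem des4_ok : check 13 13 des4 = true := by decide +kernel

def des5 : List BB :=
  [(0, 10, 12, 15, 4), (0, 9, 8, 10, 3), (0, 1, 12, 4, 2), (0, 14, 5, 11, 1), (0, 13, 6, 4, 0)]

theorem des5_ok : check 16 16 des5 = true := by decide +kernel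

def des6 : List BB :=
  [(0, 1, 8, 3, 4), (0, 18, 11, 16, 5), (0, 13, 10, 15, 3), (0, 6, 9, 4, 2), (0, 6, 18, 10, 0),
   (0, 13, 1, 9, 1)]

theorem des6_ok : check 19 19 des6 = true := by decide +kernel

def des7 : List BB :=
  [(0, 20, 19, 11, 1), (0, 2, 3, 11, 0), (0, 18, 12, 19, 6), (0, 4, 10, 3, 4), (0, 10, 17, 15, 5),
   (0, 18, 8, 2, 3), (0, 14, 5, 9, 2)]

theorem des7_ok : check 22 22 des7 = true := by decide +kernel

def des8 : List BB :=
  [(0, 12, 21, 11, 6), (0, 13, 4, 14, 7), (0, 11, 9, 6, 3), (0, 14, 16, 19, 2),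
   (0, 19, 24, 17, 5), (0, 6, 1, 8, 4), (0, 4, 7, 17, 0), (0, 21, 18, 8, 1)]

theorem des8_ok : check 25 25 des8 = true := by decide +kernel

def des9 : List BB :=
  [(0, 11, 2, 25, 5), (0, 17, 26, 3, 4), (0, 16, 6, 1, 1), (0, 12, 22, 27, 2), (0, 19, 13, 21, 8),
   (0, 9, 15, 7, 0), (0, 21, 24, 25, 7), (0, 7, 18, 17, 6), (0, 4, 24, 12, 3)]

theorem des9_ok : check 28 28 des9 = true := by decide +kernel

def des10 : List BB :=
  [(0, 27, 22, 21, 1), (0, 4, 9, 10, 0), (0, 24, 23, 5, 3), (0, 7, 8, 26, 2), (0, 4, 21, 6, 9),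
   (0, 27, 10, 25, 8), (0, 24, 8, 11, 7), (0, 7, 23, 20, 6), (0, 11, 28, 9, 5), (0, 20, 3, 22, 4)]

theorem des10_ok : check 31 31 des10 = true := by decide +kernel

def des11 : List BB :=
  [(0, 14, 13, 19, 7), (0, 20, 21, 15, 8), (0, 27, 25, 3, 3), (0, 7, 9, 31, 2), (0, 26, 23, 4, 5),
   (0, 8, 11, 30, 4), (0, 6, 7, 17, 0), (0, 28, 27, 17, 6), (0, 2, 16, 32, 1), (0, 8, 21, 26, 10),
   (0, 29, 20, 4, 9)]

theorem des11_ok : check 34 34 des11 = true := by decide +kernel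

def des12 : List BB :=
  [(0, 30, 32, 21, 10), (0, 7, 5, 16, 11), (0, 34, 15, 21, 8), (0, 3, 22, 16, 9),
   (0, 4, 29, 15, 5), (0, 33, 8, 22, 4), (0, 10, 34, 33, 7), (0, 27, 3, 4, 6), (0, 19, 25, 20, 3),
   (0, 18, 12, 17, 2), (0, 29, 2, 9, 0), (0, 8, 35, 28, 1)]

theorem des12_ok : check 37 37 des12 = true := by decide +kernel

def des13 : List BB :=
  [(0, 38, 16, 25, 1), (0, 2, 24, 15, 0), (0, 6, 5, 31, 3), (0, 34, 35, 9, 6), (0, 35, 38, 27, 5),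
   (0, 5, 2, 13, 4), (0, 37, 23, 19, 11), (0, 3, 17, 21, 12), (0, 23, 11, 30, 9),
   (0, 17, 29, 10, 8), (0, 32, 39, 33, 2), (0, 8, 12, 28, 10), (0, 10, 6, 30, 7)]

theorem des13_ok : check 40 40 des13 = true := by decide +kernel

def des14 : List BB :=
  [(0, 6, 16, 42, 7), (0, 37, 27, 1, 6), (0, 40, 38, 16, 12), (0, 3, 5, 27, 2), (0, 32, 14, 1, 9),
   (0, 11, 29, 42, 8), (0, 3, 9, 7, 1), (0, 40, 34, 36, 3), (0, 25, 30, 10, 5),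
   (0, 18, 13, 33, 4), (0, 35, 20, 24, 11), (0, 8, 23, 19, 10), (0, 26, 35, 14, 13),
   (0, 17, 8, 29, 0)]

theorem des14_ok : check 43 43 des14 = true := by decide +kernel

def des15 : List BB :=
  [(0, 36, 15, 14, 13), (0, 10, 31, 32, 14), (0, 23, 5, 35, 2), (0, 23, 41, 11, 8),
   (0, 6, 39, 20, 6), (0, 40, 7, 26, 9), (0, 13, 11, 42, 4), (0, 33, 35, 4, 12),
   (0, 9, 39, 12, 3), (0, 37, 7, 34, 5), (0, 9, 1, 6, 11), (0, 37, 45, 40, 10), (0, 44, 22, 2, 7),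
   (0, 42, 17, 25, 0), (0, 38, 20, 10, 1)]

theorem des15_ok : check 46 46 des15 = true := by decide +kernel

def des16 : List BB :=
  [(0, 25, 7, 3, 1), (0, 24, 42, 46, 0), (0, 16, 48, 5, 3), (0, 33, 1, 44, 2),
   (0, 16, 14, 39, 15), (0, 33, 35, 10, 14), (0, 20, 14, 1, 7), (0, 29, 35, 48, 6),
   (0, 22, 31, 10, 9), (0, 27, 18, 39, 8), (0, 41, 3, 37, 13), (0, 8, 46, 12, 12),
   (0, 13, 20, 5, 11), (0, 36, 29, 44, 10), (0, 47, 17, 26, 5), (0, 2, 32, 23, 4)]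

theorem des16_ok : check 49 49 des16 = true := by decide +kernel

def des17 : List BB :=
  [(0, 38, 5, 41, 1), (0, 14, 47, 11, 0), (0, 51, 30, 2, 11), (0, 1, 22, 50, 10),
   (0, 4, 22, 27, 13), (0, 48, 30, 25, 12), (0, 12, 13, 28, 2), (0, 40, 39, 24, 3),
   (0, 20, 45, 35, 16), (0, 32, 7, 17, 15), (0, 10, 41, 33, 8), (0, 42, 11, 19, 9),
   (0, 45, 2, 6, 5), (0, 7, 50, 46, 14), (0, 35, 17, 26, 4), (0, 20, 8, 14, 6), (0, 32, 44, 18, 7)]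

theorem des17_ok : check 52 52 des17 = true := by decide +kernel

def des18 : List BB :=
  [(0, 27, 16, 30, 9), (0, 28, 39, 25, 8), (0, 1, 43, 48, 10), (0, 54, 12, 7, 11),
   (0, 39, 24, 33, 5), (0, 16, 31, 22, 4), (0, 48, 30, 26, 7), (0, 7, 25, 29, 6),
   (0, 27, 12, 10, 14), (0, 28, 43, 45, 15), (0, 26, 21, 35, 1), (0, 29, 34, 20, 0),
   (0, 23, 4, 10, 17), (0, 32, 51, 45, 16), (0, 1, 36, 38, 3), (0, 54, 19, 17, 2),
   (0, 21, 44, 52, 13), (0, 34, 11, 3, 12)]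

theorem des18_ok : check 55 55 des18 = true := by decide +kernel

def des19 : List BB :=
  [(0, 25, 20, 14, 1), (0, 33, 38, 44, 0), (0, 26, 44, 10, 4), (0, 32, 14, 48, 5),
   (0, 27, 1, 24, 2), (0, 31, 57, 34, 3), (0, 41, 50, 21, 6), (0, 17, 8, 37, 7),
   (0, 8, 36, 27, 9), (0, 50, 22, 31, 14), (0, 54, 18, 33, 12), (0, 4, 40, 25, 13),
   (0, 4, 17, 15, 10), (0, 54, 41, 43, 11), (0, 39, 46, 16, 15), (0, 19, 12, 42, 8),
   (0, 7, 10, 5, 17), (0, 51, 6, 52, 18), (0, 55, 45, 57, 16)]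

theorem des19_ok : check 58 58 des19 = true := by decide +kernel

def des20 : List BB :=
  [(0, 33, 35, 29, 6), (0, 28, 26, 32, 7), (0, 5, 51, 11, 3), (0, 56, 10, 50, 2),
   (0, 60, 47, 9, 5), (0, 1, 14, 52, 4), (0, 11, 33, 31, 0), (0, 50, 28, 30, 1),
   (0, 49, 7, 46, 18), (0, 12, 54, 15, 19), (0, 45, 24, 44, 11), (0, 16, 37, 17, 10),
   (0, 18, 42, 47, 17), (0, 43, 19, 14, 16), (0, 8, 34, 31, 15), (0, 53, 27, 30, 14),
   (0, 18, 54, 45, 13), (0, 43, 7, 16, 12), (0, 17, 53, 4, 8), (0, 44, 8, 57, 9)]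

theorem des20_ok : check 61 61 des20 = true := by decide +kernel

def des21 : List BB :=
  [(0, 2, 56, 15, 5), (0, 62, 8, 49, 20), (0, 14, 25, 44, 4), (0, 50, 39, 20, 15),
   (0, 2, 35, 24, 2), (0, 62, 29, 40, 0), (0, 42, 17, 55, 7), (0, 22, 47, 9, 6),
   (0, 61, 57, 56, 10), (0, 3, 7, 8, 11), (0, 18, 21, 1, 8), (0, 46, 43, 63, 9),
   (0, 21, 33, 48, 13), (0, 43, 31, 16, 12), (0, 5, 37, 23, 14), (0, 59, 27, 41, 3),
   (0, 28, 57, 19, 18), (0, 36, 7, 45, 19), (0, 36, 60, 48, 16), (0, 40, 6, 34, 17),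
   (0, 4, 58, 10, 1)]

theorem des21_ok : check 64 64 des21 = true := by decide +kernel

def des22 : List BB :=
  [(0, 12, 36, 7, 5), (0, 55, 31, 60, 4), (0, 33, 20, 6, 19), (0, 34, 47, 61, 18),
   (0, 33, 8, 32, 1), (0, 34, 59, 35, 0), (0, 6, 10, 31, 17), (0, 61, 57, 36, 16),
   (0, 48, 32, 11, 9), (0, 19, 35, 56, 8), (0, 37, 38, 28, 11), (0, 30, 29, 39, 10),
   (0, 8, 52, 55, 13), (0, 59, 15, 12, 12), (0, 26, 9, 53, 20), (0, 41, 58, 14, 21),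
   (0, 60, 45, 49, 7), (0, 7, 22, 18, 6), (0, 64, 51, 2, 3), (0, 3, 16, 65, 2),
   (0, 50, 48, 22, 15), (0, 17, 19, 45, 14)]

theorem des22_ok : check 67 67 des22 = true := by decide +kernel

def des23 : List BB :=
  [(0, 18, 22, 43, 21), (0, 52, 48, 27, 20), (0, 67, 54, 39, 15), (0, 3, 16, 31, 16),
   (0, 51, 45, 43, 5), (0, 19, 25, 27, 10), (0, 64, 69, 10, 7), (0, 6, 1, 60, 6),
   (0, 35, 66, 13, 9), (0, 35, 4, 57, 8), (0, 24, 26, 7, 4), (0, 46, 44, 63, 12),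
   (0, 24, 38, 50, 11), (0, 46, 32, 20, 14), (0, 9, 23, 8, 13), (0, 61, 47, 62, 2),
   (0, 41, 38, 5, 3), (0, 29, 32, 65, 18), (0, 37, 9, 49, 17), (0, 33, 61, 21, 22),
   (0, 18, 11, 47, 1), (0, 52, 59, 23, 0), (0, 50, 20, 10, 19)]

theorem des23_ok : check 70 70 des23 = true := by decide +kernel

def des24 : List BB :=
  [(0, 49, 67, 23, 1), (0, 24, 6, 50, 0), (0, 6, 44, 13, 8), (0, 67, 29, 60, 9),
   (0, 16, 21, 71, 5), (0, 57, 52, 2, 4), (0, 4, 1, 14, 23), (0, 69, 72, 59, 22),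
   (0, 27, 58, 47, 2), (0, 46, 15, 26, 3), (0, 40, 57, 49, 21), (0, 33, 16, 24, 20),
   (0, 66, 34, 12, 13), (0, 7, 39, 61, 12), (0, 5, 19, 56, 19), (0, 68, 54, 17, 18),
   (0, 40, 15, 43, 17), (0, 33, 58, 30, 16), (0, 63, 27, 25, 15), (0, 10, 46, 48, 14),
   (0, 52, 61, 53, 11), (0, 21, 12, 20, 10), (0, 4, 43, 32, 7), (0, 69, 30, 41, 6)]

theorem des24_ok : check 73 73 des24 = true := by decide +kernel

def des25 : List BB :=
  [(0, 36, 4, 59, 20), (0, 40, 72, 17, 21), (0, 40, 53, 5, 0), (0, 36, 23, 71, 2),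
   (0, 75, 51, 69, 5), (0, 1, 25, 7, 4), (0, 16, 62, 4, 22), (0, 60, 14, 72, 12),
   (0, 65, 20, 59, 15), (0, 11, 56, 17, 14), (0, 14, 34, 22, 11), (0, 62, 42, 54, 10),
   (0, 16, 19, 61, 7), (0, 60, 57, 15, 24), (0, 39, 38, 48, 9), (0, 37, 38, 28, 8),
   (0, 24, 22, 51, 17), (0, 52, 54, 25, 16), (0, 43, 69, 2, 23), (0, 33, 7, 74, 18),
   (0, 61, 11, 32, 19), (0, 15, 65, 44, 1), (0, 8, 27, 57, 6), (0, 73, 10, 43, 3),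
   (0, 3, 66, 71, 13)]

theorem des25_ok : check 76 76 des25 = true := by decide +kernel

def des26 : List BB :=
  [(0, 30, 7, 46, 12), (0, 49, 72, 33, 13), (0, 67, 11, 8, 16), (0, 12, 68, 71, 17),
   (0, 48, 50, 65, 22), (0, 31, 29, 14, 23), (0, 77, 19, 6, 7), (0, 2, 60, 73, 6),
   (0, 75, 7, 53, 9), (0, 4, 72, 26, 8), (0, 47, 38, 4, 20), (0, 32, 41, 75, 21),
   (0, 40, 35, 54, 0), (0, 39, 44, 25, 1), (0, 55, 17, 61, 25), (0, 24, 62, 18, 24),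
   (0, 10, 22, 59, 2), (0, 69, 57, 20, 3), (0, 1, 28, 10, 19), (0, 78, 51, 69, 18),
   (0, 42, 13, 45, 10), (0, 37, 66, 34, 11), (0, 31, 16, 74, 4), (0, 48, 63, 5, 5),
   (0, 55, 28, 54, 15), (0, 24, 51, 25, 14)]

theorem des26_ok : check 79 79 des26 = true := by decide +kernel

def des27 : List BB :=
  [(0, 18, 61, 75, 23), (0, 64, 21, 7, 25), (0, 1, 4, 63, 3), (0, 81, 78, 19, 2),
   (0, 28, 17, 49, 8), (0, 54, 65, 33, 26), (0, 16, 60, 45, 7), (0, 66, 22, 37, 6),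
   (0, 77, 6, 80, 9), (0, 5, 76, 2, 22), (0, 10, 22, 41, 11), (0, 72, 60, 41, 10),
   (0, 31, 73, 15, 13), (0, 51, 9, 67, 12), (0, 2, 9, 58, 15), (0, 80, 73, 24, 14),
   (0, 52, 27, 53, 17), (0, 30, 55, 29, 16), (0, 35, 62, 45, 20), (0, 47, 20, 37, 21),
   (0, 46, 12, 59, 18), (0, 36, 70, 23, 19), (0, 77, 38, 8, 1), (0, 5, 44, 74, 0),
   (0, 54, 4, 40, 4), (0, 50, 46, 64, 24), (0, 42, 48, 76, 5)]

theorem des27_ok : check 82 82 des27 = true := by decide +kernel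

def des28 : List BB :=
  [(0, 16, 57, 37, 11), (0, 69, 28, 48, 10), (0, 33, 22, 17, 25), (0, 52, 63, 68, 24),
   (0, 62, 59, 83, 5), (0, 23, 26, 2, 4), (0, 70, 14, 34, 16), (0, 15, 71, 51, 17),
   (0, 66, 12, 62, 14), (0, 19, 73, 23, 15), (0, 39, 40, 81, 1), (0, 46, 45, 4, 0),
   (0, 22, 7, 60, 23), (0, 63, 78, 25, 22), (0, 66, 35, 71, 9), (0, 19, 50, 14, 8),
   (0, 56, 26, 84, 6), (0, 29, 59, 1, 7), (0, 42, 52, 55, 20), (0, 43, 33, 30, 21),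
   (0, 68, 58, 76, 18), (0, 17, 27, 9, 19), (0, 2, 79, 47, 13), (0, 83, 6, 38, 12),
   (0, 78, 67, 6, 3), (0, 7, 18, 79, 2), (0, 51, 39, 76, 27), (0, 34, 46, 9, 26)]

theorem des28_ok : check 85 85 des28 = true := by decide +kernel

def des29 : List BB :=
  [(0, 79, 11, 35, 27), (0, 9, 77, 53, 28), (0, 74, 28, 12, 3), (0, 14, 60, 76, 7),
   (0, 19, 82, 27, 5), (0, 69, 6, 61, 4), (0, 23, 13, 59, 13), (0, 65, 75, 29, 12),
   (0, 82, 65, 80, 9), (0, 6, 23, 8, 8), (0, 60, 1, 48, 11), (0, 28, 87, 40, 10),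
   (0, 81, 24, 14, 22), (0, 7, 64, 74, 6), (0, 83, 86, 25, 23), (0, 5, 2, 63, 26),
   (0, 84, 58, 51, 19), (0, 4, 30, 37, 18), (0, 43, 39, 21, 17), (0, 45, 49, 67, 16),
   (0, 87, 49, 17, 24), (0, 1, 39, 71, 25), (0, 83, 52, 68, 2), (0, 5, 36, 20, 14),
   (0, 34, 66, 53, 20), (0, 54, 22, 35, 21), (0, 3, 51, 40, 15), (0, 9, 43, 54, 0),
   (0, 79, 41, 38, 1)]

theorem des29_ok : check 88 88 des29 = true := by decide +kernel

def des30 : List BB :=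
  [(0, 45, 84, 79, 1), (0, 46, 7, 12, 0), (0, 23, 29, 44, 18), (0, 68, 62, 47, 19),
   (0, 82, 61, 1, 8), (0, 9, 30, 90, 9), (0, 33, 47, 87, 24), (0, 58, 44, 4, 25),
   (0, 23, 83, 86, 4), (0, 68, 8, 5, 5), (0, 54, 41, 26, 11), (0, 37, 50, 65, 10),
   (0, 64, 42, 45, 13), (0, 27, 49, 46, 12), (0, 32, 57, 33, 28), (0, 59, 34, 58, 29),
   (0, 87, 74, 39, 17), (0, 4, 17, 52, 16), (0, 62, 56, 80, 2), (0, 29, 35, 11, 3),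
   (0, 53, 41, 61, 23), (0, 38, 50, 30, 22), (0, 75, 2, 22, 21), (0, 16, 89, 69, 20),
   (0, 42, 40, 26, 6), (0, 49, 51, 65, 7), (0, 81, 64, 9, 27), (0, 10, 27, 82, 26),
   (0, 55, 7, 66, 14), (0, 36, 84, 25, 15)]

theorem des30_ok : check 91 91 des30 = true := by decide +kernel

def des31 : List BB :=
  [(0, 27, 32, 90, 29), (0, 67, 62, 4, 16), (0, 25, 38, 15, 3), (0, 69, 56, 79, 2),
   (0, 7, 45, 75, 20), (0, 87, 49, 19, 21), (0, 73, 23, 32, 18), (0, 21, 71, 62, 19),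
   (0, 61, 6, 35, 9), (0, 33, 88, 59, 8), (0, 1, 41, 51, 11), (0, 93, 53, 43, 10),
   (0, 76, 65, 93, 13), (0, 18, 29, 1, 12), (0, 24, 81, 79, 22), (0, 70, 13, 15, 23),
   (0, 27, 74, 11, 1), (0, 67, 20, 83, 17), (0, 14, 75, 66, 6), (0, 80, 19, 28, 7),
   (0, 74, 22, 86, 4), (0, 20, 72, 8, 5), (0, 80, 3, 73, 14), (0, 14, 91, 21, 15),
   (0, 72, 37, 3, 25), (0, 22, 57, 91, 24), (0, 5, 51, 45, 27), (0, 89, 43, 49, 26),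
   (0, 4, 90, 12, 30), (0, 36, 34, 82, 0), (0, 58, 76, 60, 28)]

theorem des31_ok : check 94 94 des31 = true := by decide +kernel

def des32 : List BB :=
  [(0, 88, 95, 35, 1), (0, 9, 2, 62, 0), (0, 76, 25, 77, 16), (0, 21, 72, 20, 17),
   (0, 31, 59, 94, 29), (0, 66, 38, 3, 28), (0, 24, 36, 74, 7), (0, 73, 61, 23, 6),
   (0, 81, 48, 70, 14), (0, 16, 49, 27, 15), (0, 74, 7, 3, 23), (0, 23, 90, 94, 22),
   (0, 39, 50, 6, 13), (0, 58, 47, 91, 12), (0, 89, 5, 21, 31), (0, 8, 92, 76, 30),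
   (0, 10, 79, 27, 2), (0, 87, 18, 70, 3), (0, 14, 63, 9, 27), (0, 83, 34, 88, 26),
   (0, 14, 20, 56, 21), (0, 83, 77, 41, 20), (0, 22, 82, 78, 9), (0, 75, 15, 19, 8),
   (0, 15, 57, 39, 25), (0, 82, 40, 58, 24), (0, 43, 72, 26, 19), (0, 54, 25, 71, 18),
   (0, 31, 32, 19, 5), (0, 66, 65, 78, 4), (0, 89, 87, 57, 10), (0, 8, 10, 40, 11)]

theorem des32_ok : check 97 97 des32 = true := by decide +kernel

def des33 : List BB :=
  [(0, 35, 43, 12, 1), (0, 65, 57, 88, 11), (0, 79, 20, 72, 28), (0, 21, 80, 28, 29),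
   (0, 7, 53, 56, 31), (0, 93, 47, 44, 4), (0, 25, 61, 59, 26), (0, 75, 39, 41, 27),
   (0, 69, 26, 87, 9), (0, 31, 74, 13, 8), (0, 14, 6, 38, 0), (0, 86, 94, 62, 30),
   (0, 17, 70, 72, 13), (0, 83, 30, 28, 12), (0, 26, 10, 88, 32), (0, 74, 90, 12, 21),
   (0, 90, 96, 1, 25), (0, 10, 4, 99, 24), (0, 49, 64, 91, 19), (0, 51, 36, 9, 18),
   (0, 87, 9, 27, 14), (0, 13, 91, 73, 20), (0, 71, 11, 48, 23), (0, 29, 89, 52, 22),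
   (0, 5, 37, 81, 17), (0, 95, 63, 19, 16), (0, 75, 30, 33, 6), (0, 25, 70, 67, 7),
   (0, 29, 50, 33, 2), (0, 71, 50, 67, 3), (0, 84, 85, 99, 15), (0, 54, 34, 20, 10),
   (0, 46, 65, 81, 5)]

theorem des33_ok : check 100 100 des33 = true := by decide +kernel

def des34 : List BB :=
  [(0, 54, 8, 82, 18), (0, 49, 95, 21, 19), (0, 56, 32, 18, 21), (0, 47, 71, 85, 20),
   (0, 2, 102, 91, 5), (0, 101, 1, 12, 4), (0, 81, 76, 30, 10), (0, 22, 27, 73, 11),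
   (0, 15, 28, 86, 9), (0, 88, 75, 17, 8), (0, 5, 55, 36, 6), (0, 98, 48, 67, 7),
   (0, 44, 69, 50, 14), (0, 59, 34, 53, 15), (0, 78, 48, 40, 12), (0, 25, 55, 63, 13),
   (0, 43, 47, 37, 30), (0, 60, 56, 66, 31), (0, 90, 16, 7, 0), (0, 13, 87, 96, 1),
   (0, 79, 80, 101, 3), (0, 24, 23, 2, 2), (0, 41, 64, 10, 23), (0, 62, 39, 93, 22),
   (0, 33, 94, 36, 27), (0, 70, 9, 67, 26), (0, 61, 96, 34, 25), (0, 42, 7, 69, 24),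
   (0, 70, 85, 59, 33), (0, 33, 18, 44, 32), (0, 99, 64, 12, 16), (0, 4, 39, 91, 17),
   (0, 20, 86, 60, 29), (0, 83, 17, 43, 28)]

theorem des34_ok : check 103 103 des34 = true := by decide +kernel

def des35 : List BB :=
  [(0, 57, 63, 35, 1), (0, 49, 43, 71, 0), (0, 83, 71, 85, 33), (0, 23, 35, 21, 9),
   (0, 76, 87, 18, 15), (0, 30, 19, 88, 14), (0, 64, 102, 40, 13), (0, 42, 4, 66, 12),
   (0, 12, 11, 39, 32), (0, 94, 95, 67, 3), (0, 93, 57, 67, 27), (0, 13, 49, 39, 26),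
   (0, 73, 3, 41, 20), (0, 33, 103, 65, 6), (0, 64, 101, 45, 7), (0, 42, 5, 61, 4),
   (0, 77, 102, 54, 25), (0, 29, 4, 52, 24), (0, 20, 17, 72, 19), (0, 86, 89, 34, 18),
   (0, 33, 17, 8, 21), (0, 73, 89, 98, 34), (0, 66, 7, 98, 23), (0, 40, 99, 8, 22),
   (0, 9, 86, 88, 17), (0, 97, 20, 18, 16), (0, 6, 99, 65, 11), (0, 100, 7, 41, 10),
   (0, 75, 22, 85, 29), (0, 31, 84, 21, 28), (0, 82, 26, 31, 31), (0, 24, 80, 75, 30),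
   (0, 46, 61, 62, 8), (0, 92, 46, 91, 2), (0, 76, 30, 14, 5)]

theorem des35_ok : check 106 106 des35 = true := by decide +kernel

def des36 : List BB :=
  [(0, 45, 21, 47, 32), (0, 64, 88, 62, 33), (0, 22, 98, 41, 7), (0, 87, 11, 68, 6),
   (0, 25, 59, 74, 10), (0, 84, 50, 35, 11), (0, 80, 23, 71, 3), (0, 29, 86, 38, 2),
   (0, 38, 47, 73, 9), (0, 71, 62, 36, 8), (0, 37, 22, 19, 21), (0, 72, 87, 90, 20),
   (0, 58, 108, 81, 13), (0, 51, 1, 28, 12), (0, 93, 91, 61, 15), (0, 16, 18, 48, 14),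
   (0, 78, 46, 67, 30), (0, 31, 63, 42, 31), (0, 63, 73, 7, 19), (0, 46, 36, 102, 18),
   (0, 106, 51, 92, 35), (0, 3, 58, 17, 34), (0, 96, 4, 101, 28), (0, 13, 105, 8, 29),
   (0, 84, 64, 8, 25), (0, 25, 45, 101, 24), (0, 44, 4, 43, 27), (0, 65, 105, 66, 26),
   (0, 12, 82, 40, 22), (0, 97, 27, 69, 23), (0, 31, 103, 96, 16), (0, 78, 6, 13, 17),
   (0, 24, 30, 14, 0), (0, 85, 79, 95, 1), (0, 29, 104, 49, 4), (0, 80, 5, 60, 5)]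

theorem des36_ok : check 109 109 des36 = true := by decide +kernel

def des37 : List BB :=
  [(0, 89, 20, 45, 13), (0, 23, 92, 67, 15), (0, 59, 35, 7, 11), (0, 53, 77, 105, 10),
   (0, 49, 71, 85, 32), (0, 63, 41, 27, 33), (0, 32, 55, 53, 7), (0, 80, 57, 59, 6),
   (0, 82, 79, 6, 31), (0, 30, 33, 106, 30), (0, 75, 51, 83, 3), (0, 37, 61, 29, 2),
   (0, 66, 91, 5, 26), (0, 46, 21, 107, 0), (0, 58, 15, 71, 14), (0, 54, 97, 41, 1),
   (0, 30, 111, 64, 17), (0, 82, 1, 48, 16), (0, 42, 34, 27, 19), (0, 70, 78, 85, 18),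
   (0, 38, 39, 58, 28), (0, 74, 73, 54, 29), (0, 26, 81, 64, 23), (0, 86, 31, 48, 22),
   (0, 62, 106, 95, 27), (0, 50, 6, 17, 35), (0, 40, 29, 75, 12), (0, 72, 83, 37, 24),
   (0, 4, 9, 102, 20), (0, 108, 103, 10, 21), (0, 4, 103, 100, 9), (0, 108, 9, 12, 8),
   (0, 65, 16, 110, 4), (0, 47, 96, 2, 5), (0, 102, 12, 84, 36), (0, 62, 50, 90, 25),
   (0, 10, 52, 70, 34)]

theorem des37_ok : check 112 112 des37 = true := by decide +kernel

def des38 : List BB :=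
  [(0, 88, 33, 65, 23), (0, 27, 82, 50, 22), (0, 75, 37, 71, 18), (0, 40, 78, 44, 19),
   (0, 76, 63, 22, 37), (0, 39, 52, 93, 36), (0, 1, 7, 57, 10), (0, 114, 108, 58, 11),
   (0, 47, 45, 76, 31), (0, 68, 70, 39, 30), (0, 109, 61, 30, 6), (0, 6, 54, 85, 7),
   (0, 101, 21, 20, 27), (0, 14, 94, 95, 26), (0, 27, 3, 69, 15), (0, 88, 112, 46, 14),
   (0, 37, 32, 20, 17), (0, 78, 83, 95, 16), (0, 38, 96, 10, 2), (0, 77, 19, 105, 3),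
   (0, 85, 107, 15, 21), (0, 30, 8, 100, 20), (0, 60, 108, 49, 1), (0, 55, 7, 66, 0),
   (0, 16, 106, 3, 33), (0, 99, 9, 112, 32), (0, 91, 9, 110, 13), (0, 24, 106, 5, 12),
   (0, 72, 107, 89, 29), (0, 43, 8, 26, 28), (0, 47, 89, 99, 9), (0, 68, 26, 16, 8),
   (0, 90, 46, 28, 25), (0, 25, 69, 87, 24), (0, 51, 15, 11, 35), (0, 64, 100, 104, 34),
   (0, 74, 72, 21, 5), (0, 41, 43, 94, 4)]

theorem des38_ok : check 115 115 des38 = true := by decide +kernel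

def des39 : List BB :=
  [(0, 97, 94, 52, 1), (0, 21, 24, 66, 0), (0, 35, 19, 55, 4), (0, 83, 99, 63, 5),
   (0, 113, 2, 18, 2), (0, 5, 116, 100, 3), (0, 101, 37, 112, 10), (0, 17, 81, 6, 15),
   (0, 60, 21, 113, 9), (0, 58, 97, 5, 28), (0, 65, 82, 25, 6), (0, 53, 36, 93, 27),
   (0, 12, 11, 59, 26), (0, 106, 107, 59, 25), (0, 85, 10, 62, 29), (0, 33, 108, 56, 7),
   (0, 50, 117, 63, 17), (0, 68, 1, 55, 16), (0, 77, 90, 50, 32), (0, 41, 28, 68, 33),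
   (0, 74, 112, 83, 35), (0, 44, 6, 35, 34), (0, 84, 99, 92, 24), (0, 34, 19, 26, 38),
   (0, 94, 46, 80, 22), (0, 24, 72, 38, 13), (0, 57, 49, 37, 12), (0, 61, 69, 81, 11),
   (0, 79, 46, 76, 37), (0, 39, 72, 42, 14), (0, 114, 45, 96, 31), (0, 4, 73, 22, 30),
   (0, 86, 9, 96, 18), (0, 32, 109, 22, 19), (0, 27, 25, 114, 21), (0, 91, 93, 4, 20),
   (0, 62, 90, 30, 8), (0, 88, 14, 74, 36), (0, 32, 47, 103, 23)]

theorem des39_ok : check 118 118 des39 = true := by decide +kernel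

def des40 : List BB :=
  [(0, 117, 81, 37, 39), (0, 4, 40, 84, 38), (0, 29, 57, 91, 36), (0, 92, 64, 30, 37),
   (0, 115, 91, 52, 30), (0, 6, 30, 69, 31), (0, 120, 71, 102, 24), (0, 1, 50, 19, 25),
   (0, 43, 5, 108, 9), (0, 78, 116, 13, 8), (0, 116, 109, 64, 35), (0, 5, 12, 57, 34),
   (0, 33, 107, 48, 13), (0, 88, 14, 73, 12), (0, 96, 29, 79, 15), (0, 25, 92, 42, 14),
   (0, 25, 119, 39, 17), (0, 96, 2, 82, 16), (0, 111, 13, 11, 29), (0, 10, 108, 110, 28),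
   (0, 24, 87, 99, 21), (0, 97, 34, 22, 20), (0, 42, 16, 102, 23), (0, 79, 105, 19, 22),
   (0, 33, 53, 22, 6), (0, 88, 68, 99, 7), (0, 70, 3, 38, 32), (0, 51, 118, 83, 33),
   (0, 76, 66, 20, 19), (0, 45, 55, 101, 18), (0, 6, 118, 95, 4), (0, 115, 3, 26, 5),
   (0, 117, 47, 68, 26), (0, 4, 74, 53, 27), (0, 15, 8, 81, 11), (0, 106, 113, 40, 10),
   (0, 1, 37, 9, 2), (0, 120, 84, 112, 3), (0, 43, 60, 16, 1), (0, 78, 61, 105, 0)]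

theorem des40_ok : check 121 121 des40 = true := by decide +kernel

def des41 : List BB :=
  [(0, 88, 79, 46, 1), (0, 36, 45, 78, 0), (0, 116, 14, 118, 28), (0, 8, 110, 6, 24),
   (0, 57, 6, 109, 37), (0, 67, 118, 15, 36), (0, 35, 69, 40, 7), (0, 89, 55, 84, 6),
   (0, 13, 113, 54, 10), (0, 111, 11, 70, 11), (0, 119, 54, 16, 8), (0, 5, 70, 108, 9),
   (0, 88, 114, 61, 16), (0, 36, 10, 63, 17), (0, 87, 2, 94, 39), (0, 37, 122, 30, 34),
   (0, 62, 45, 19, 12), (0, 62, 79, 105, 13), (0, 49, 107, 104, 19), (0, 75, 17, 20, 32),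
   (0, 25, 48, 1, 23), (0, 99, 76, 123, 22), (0, 23, 113, 61, 21), (0, 101, 11, 63, 20),
   (0, 64, 56, 105, 3), (0, 60, 68, 19, 18), (0, 96, 112, 25, 27), (0, 28, 12, 99, 26),
   (0, 80, 115, 93, 2), (0, 44, 9, 31, 35), (0, 27, 31, 30, 31), (0, 97, 93, 94, 30),
   (0, 18, 76, 33, 33), (0, 106, 48, 91, 38), (0, 44, 56, 95, 15), (0, 80, 68, 29, 29),
   (0, 40, 114, 47, 5), (0, 84, 10, 77, 4), (0, 120, 14, 74, 40), (0, 46, 96, 4, 14),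
   (0, 110, 28, 92, 25)]

theorem des41_ok : check 124 124 des41 = true := by decide +kernel

def des43 : List BB :=
  [(0, 125, 51, 25, 1), (0, 5, 79, 105, 0), (0, 38, 96, 1, 29), (0, 92, 34, 129, 28),
   (0, 33, 119, 17, 5), (0, 97, 11, 113, 4), (0, 81, 121, 54, 31), (0, 49, 9, 76, 30),
   (0, 82, 112, 25, 9), (0, 48, 18, 105, 8), (0, 69, 77, 43, 12), (0, 61, 53, 87, 13),
   (0, 120, 13, 5, 10), (0, 10, 117, 125, 11), (0, 36, 101, 91, 42), (0, 94, 29, 39, 15),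
   (0, 27, 89, 50, 17), (0, 103, 41, 80, 16), (0, 53, 72, 75, 19), (0, 77, 58, 55, 18),
   (0, 99, 70, 42, 25), (0, 31, 60, 88, 24), (0, 48, 51, 47, 38), (0, 82, 79, 83, 39),
   (0, 124, 93, 109, 21), (0, 6, 37, 21, 20), (0, 95, 63, 17, 27), (0, 35, 67, 113, 26),
   (0, 111, 59, 97, 3), (0, 19, 71, 33, 2), (0, 81, 12, 88, 7), (0, 49, 118, 42, 6),
   (0, 110, 64, 40, 40), (0, 20, 66, 90, 41), (0, 108, 110, 121, 35), (0, 22, 20, 9, 34),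
   (0, 85, 21, 14, 37), (0, 45, 109, 116, 36), (0, 4, 6, 89, 22), (0, 126, 124, 41, 23),
   (0, 12, 36, 86, 32), (0, 118, 56, 32, 33), (0, 80, 98, 62, 14)]

theorem des43_ok : check 130 130 des43 = true := by decide +kernel

def des44 : List BB :=
  [(0, 114, 29, 131, 43), (0, 19, 104, 2, 42), (0, 5, 25, 54, 3), (0, 128, 108, 79, 2),
   (0, 37, 71, 94, 32), (0, 96, 62, 39, 33), (0, 55, 112, 100, 7), (0, 78, 21, 33, 6),
   (0, 123, 117, 36, 16), (0, 10, 16, 97, 17), (0, 93, 3, 51, 21), (0, 40, 130, 82, 20),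
   (0, 13, 77, 116, 13), (0, 120, 56, 17, 12), (0, 24, 66, 13, 38), (0, 109, 67, 120, 39),
   (0, 68, 78, 132, 8), (0, 65, 55, 1, 9), (0, 15, 107, 127, 30), (0, 118, 26, 6, 31),
   (0, 36, 131, 41, 11), (0, 97, 2, 92, 10), (0, 67, 63, 32, 23), (0, 66, 70, 101, 22),
   (0, 107, 9, 93, 25), (0, 26, 124, 40, 24), (0, 59, 103, 121, 41), (0, 74, 30, 12, 40),
   (0, 22, 105, 60, 29), (0, 111, 28, 73, 28), (0, 59, 44, 52, 18), (0, 74, 89, 81, 19),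
   (0, 61, 37, 3, 4), (0, 72, 96, 130, 5), (0, 77, 14, 86, 35), (0, 56, 119, 47, 34),
   (0, 122, 106, 129, 37), (0, 11, 27, 4, 36), (0, 22, 75, 47, 14), (0, 111, 58, 86, 15),
   (0, 18, 100, 101, 27), (0, 115, 33, 32, 26), (0, 60, 87, 68, 1), (0, 73, 46, 65, 0)]

theorem des44_ok : check 133 133 des44 = true := by decide +kernel

/-- The complete directed graph on `3u+1` points. -/
def A (u : ℕ) : Prop := Good (fun x y : Fin (3 * u + 1) => x ≠ y)

/-- The complete multipartite graph with `k` groups of size 3. -/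
def T (k : ℕ) : Prop := Good (fun p q : Fin k × Fin 3 => p.1 ≠ q.1)

theorem A_of_check {u : ℕ} {L : List BB} (h : check (3 * u + 1) (3 * u + 1) L = true) : A u := by
  have hg := check_good h
  have e : ∀ x y : ZMod (3 * u + 1), ¬ (y - x).val % (3 * u + 1) = 0 ↔ x ≠ y := by
    intro x y
    rw [Nat.mod_eq_of_lt (ZMod.val_lt _), ZMod.val_eq_zero, sub_eq_zero, ne_comm]
  refine hg.transport (W := Fin (3 * u + 1)) (fun x => x) Set.univ (fun x _ y _ h => h)
    (fun x y _ => ⟨trivial, trivial⟩) (fun x y h => (e x y).1 h) 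
    (fun x y h => ⟨x, y, (e x y).2 h, rfl, rfl⟩)

theorem T_of_check {k : ℕ} (hk : 0 < k) {L : List BB} (h : check (3 * k) k L = true) : T k := by
  have : NeZero k := ⟨hk.ne'⟩
  have : NeZero (3 * k) := ⟨by omega⟩
  have hg := check_good h
  have e : ∀ x y : ZMod (3 * k), (y - x).val % k = 0 ↔ x.val % k = y.val % k := by
    intro x y
    have h1 : y.val = ((y - x).val + x.val) % (3 * k) := by
      rw [← ZMod.val_add, sub_add_cancel]
    have h2 : y.val % k = ((y - x).val + x.val) % k := by
      rw [h1, Nat.mod_mod_of_dvd _ (Dvd.intro_left 3 rfl)]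
    rw [h2]
    constructor
    · intro h3
      rw [Nat.add_mod, h3, zero_add, Nat.mod_mod]
    · intro h3
      have h4 : 0 + x.val ≡ (y - x).val + x.val [MOD k] := by rw [zero_add]; exact h3
      have h5 : 0 % k = (y - x).val % k := Nat.ModEq.add_right_cancel' _ h4
      rw [← h5, Nat.zero_mod]
  have hq : ∀ x : ZMod (3 * k), x.val / k < 3 := fun x =>
    Nat.div_lt_of_lt_mul ((ZMod.val_lt x).trans_eq (mul_comm 3 k))
  refine hg.transport (W := Fin k × Fin 3)
    (fun x => (⟨x.val % k, Nat.mod_lt _ hk⟩, ⟨x.val / k, hq x⟩)) Set.univ ?_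
    (fun x y _ => ⟨trivial, trivial⟩) ?_ ?_
  · intro x _ y _ h
    simp only [Prod.mk.injEq, Fin.mk.injEq] at h
    apply ZMod.val_injective
    rw [← Nat.mod_add_div x.val k, ← Nat.mod_add_div y.val k, h.1, h.2]
  · intro x y h h'
    exact h ((e x y).2 (Fin.mk.inj h'))
  · rintro ⟨i, c⟩ ⟨j, d⟩ hne
    have key : ∀ (i : Fin k) (c : Fin 3), ∃ x : ZMod (3 * k), x.val % k = i.val ∧
        x.val / k = c.val := by
      intro i c
      have hlt : i.val + k * c.val < 3 * k := by
        have := i.2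
        have := Nat.mul_le_mul_left k (show c.val ≤ 2 by omega)
        omega
      refine ⟨((i.val + k * c.val : ℕ) : ZMod (3 * k)), ?_, ?_⟩
      · rw [ZMod.val_natCast, Nat.mod_eq_of_lt hlt, Nat.add_mul_mod_self_left,
          Nat.mod_eq_of_lt i.2]
      · rw [ZMod.val_natCast, Nat.mod_eq_of_lt hlt, Nat.add_mul_div_left _ _ hk,
          Nat.div_eq_of_lt i.2, zero_add]
    obtain ⟨x, hx1, hx2⟩ := key i c
    obtain ⟨y, hy1, hy2⟩ := key j d
    refine ⟨x, y, ?_, ?_, ?_⟩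
    · intro h
      have h' := (e x y).1 h
      rw [hx1, hy1] at h'
      exact hne (Fin.ext h')
    · exact Prod.ext (Fin.ext hx1) (Fin.ext hx2)
    · exact Prod.ext (Fin.ext hy1) (Fin.ext hy2)

theorem T6 : T 6 := T_of_check (by norm_num) gdd6_ok

theorem T7 : T 7 := T_of_check (by norm_num) gdd7_ok

theorem T8 : T 8 := T_of_check (by norm_num) gdd8_ok

theorem A.on {u : ℕ} (hA : A u) {V : Type} (S : Finset V) (hS : S.card = 3 * u + 1) :
    Good (fun x y : V => x ∈ S ∧ y ∈ S ∧ x ≠ y) := by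
  let e := S.equivFinOfCardEq hS
  refine Good.transport hA (fun i => (e.symm i : V)) Set.univ 
    (fun x _ y _ h => e.symm.injective (Subtype.ext h)) (fun x y _ => ⟨trivial, trivial⟩) ?_ ?_
  · intro x y h
    exact ⟨(e.symm x).2, (e.symm y).2, fun h' => h (e.symm.injective (Subtype.ext h'))⟩
  · rintro x y ⟨hx, hy, hne⟩
    refine ⟨e ⟨x, hx⟩, e ⟨y, hy⟩, ?_, by simp, by simp⟩
    intro h
    exact hne (by simpa using e.injective h)

theorem A.of_on {u : ℕ} {V : Type} (S : Finset V) (hS : S.card = 3 * u + 1)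
    (hg : Good (fun x y : V => x ∈ S ∧ y ∈ S ∧ x ≠ y)) : A u := by
  classical
  let e := S.equivFinOfCardEq hS
  refine Good.transport hg (fun x => if h : x ∈ S then e ⟨x, h⟩ else 0) (S : Set V) ?_
    (fun x y h => ⟨h.1, h.2.1⟩) ?_ ?_
  · intro x hx y hy h
    have hx' : x ∈ S := hx
    have hy' : y ∈ S := hy
    simpa [hx', hy'] using h
  · rintro x y ⟨hx, hy, hne⟩
    simpa [hx, hy] using hne
  · intro x y hne
    refine ⟨e.symm x, e.symm y, ⟨(e.symm x).2, (e.symm y).2, ?_⟩, by simp, by simp⟩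
    intro h
    exact hne (e.symm.injective (Subtype.ext h))

theorem T.on {k : ℕ} (hT : T k) {P : Type} (U : Finset P) (hU : U.card = k) :
    Good (fun x y : Option (P × Fin 3) => ∃ p q c d, x = some (p, c) ∧ y = some (q, d) ∧
      p ∈ U ∧ q ∈ U ∧ p ≠ q) := by
  let e := U.equivFinOfCardEq hU
  refine Good.transport hT (fun i => some ((e.symm i.1 : P), i.2)) Set.univ ?_ 
    (fun x y _ => ⟨trivial, trivial⟩) ?_ ?_
  · rintro ⟨i, c⟩ _ ⟨j, d⟩ _ h
    simp only [Option.some.injEq, Prod.mk.injEq] at h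
    rw [e.symm.injective (Subtype.ext h.1), h.2]
  · rintro ⟨i, c⟩ ⟨j, d⟩ h
    exact ⟨_, _, _, _, rfl, rfl, (e.symm i).2, (e.symm j).2, 
      fun h' => h (e.symm.injective (Subtype.ext h'))⟩
  · rintro x y ⟨p, q, c, d, rfl, rfl, hp, hq, hne⟩
    refine ⟨(e ⟨p, hp⟩, c), (e ⟨q, hq⟩, d), ?_, by simp, by simp⟩
    intro h
    exact hne (by simpa using e.injective h)

/-- Incidence in the transversal design defined by slopes `e`. -/
def onLine {I R : Type} [CommRing R] (e : I → R) (l : R × R) : Option I × R → Prop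
  | (none, r) => r = l.2
  | (some i, r) => r = l.1 + e i * l.2

theorem line_exists {I R : Type} [CommRing R] (e : I → R)
    (he : ∀ i j, i ≠ j → IsUnit (e i - e j)) (p q : Option I × R) (h : p.1 ≠ q.1) :
    ∃ l, onLine e l p ∧ onLine e l q := by
  obtain ⟨g, r⟩ := p
  obtain ⟨g', r'⟩ := q
  rcases g with _ | i <;> rcases g' with _ | j
  · exact absurd rfl h
  · exact ⟨(r' - e j * r, r), rfl, by simp [onLine]⟩
  · exact ⟨(r - e i * r', r'), by simp [onLine], rfl⟩
  · have hij : i ≠ j := fun h' => h (by rw [h'])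
    obtain ⟨w, hw⟩ := (he i j hij).exists_right_inv
    refine ⟨(r - e i * (w * (r - r')), w * (r - r')), by simp [onLine], ?_⟩
    simp only [onLine]
    linear_combination (r - r') * hw

theorem line_unique {I R : Type} [CommRing R] (e : I → R)
    (he : ∀ i j, i ≠ j → IsUnit (e i - e j)) (p q : Option I × R) (h : p.1 ≠ q.1) (l l' : R × R)
    (h1 : onLine e l p) (h2 : onLine e l q) (h3 : onLine e l' p) (h4 : onLine e l' q) :
    l = l' := by
  obtain ⟨g, r⟩ := p
  obtain ⟨g', r'⟩ := q
  obtain ⟨a, b⟩ := l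
  obtain ⟨a', b'⟩ := l'
  rcases g with _ | i <;> rcases g' with _ | j <;> simp only [onLine] at h1 h2 h3 h4
  · exact absurd rfl h
  · subst h1; subst h3
    rw [h2] at h4
    rw [add_right_cancel h4]
  · subst h2; subst h4
    rw [h1] at h3
    rw [add_right_cancel h3]
  · have hij : i ≠ j := fun h' => h (by rw [h'])
    have hb : b = b' := by
      apply (he i j hij).mul_left_cancel
      linear_combination h2 - h1 + h3 - h4
    subst hb
    rw [h1] at h3
    rw [add_right_cancel h3]

/-- The main recursive construction. -/
theorem step {I R : Type} [Fintype I] [Fintype R] [CommRing R] [DecidableEq I] [DecidableEq R]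
    (e : I → R) (he : ∀ i j, i ≠ j → IsUnit (e i - e j))
    (W : Finset (Option I × R))
    (hgrp : ∀ g, (W.filter fun p => p.1 = g).card = 0 ∨ A (W.filter fun p => p.1 = g).card)
    (hline : ∀ l, ∃ U : Finset (Option I × R), (∀ p, p ∈ U ↔ p ∈ W ∧ onLine e l p) ∧ T U.card) :
    A W.card := by
  classical
  let V := Option ((Option I × R) × Fin 3)
  have emb : Function.Injective (some : (Option I × R) × Fin 3 → V) := Option.some_injective _
  let St : Finset (Option I × R) → Finset V := fun X =>
    insert none ((X ×ˢ (Finset.univ : Finset (Fin 3))).map ⟨some, emb⟩)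
  have Stcard : ∀ X, (St X).card = 3 * X.card + 1 := by
    intro X
    rw [Finset.card_insert_of_notMem (by simp), Finset.card_map, Finset.card_product]
    simp [mul_comm]
  have Stn : ∀ X, none ∈ St X := fun X => by simp [St]
  have Sts : ∀ X p c, some (p, c) ∈ St X ↔ p ∈ X := fun X p c => by simp [St]
  choose U hU hT using hline
  apply A.of_on (St W) (Stcard W)
  let adjk : (R × R) ⊕ Option I → V → V → Prop
    | .inl l => fun x y => ∃ p q c d, x = some (p, c) ∧ y = some (q, d) ∧
        p ∈ U l ∧ q ∈ U l ∧ p ≠ q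
    | .inr g => fun x y => x ∈ St (W.filter fun p => p.1 = g) ∧ 
        y ∈ St (W.filter fun p => p.1 = g) ∧ x ≠ y
  have hlg : ∀ l p q, p ∈ U l → q ∈ U l → p ≠ q → p.1 ≠ q.1 := by
    intro l p q hp hq hne h
    have h1 := ((hU l p).1 hp).2
    have h2 := ((hU l q).1 hq).2
    obtain ⟨g, r⟩ := p
    obtain ⟨g', r'⟩ := q
    replace h : g = g' := h
    subst h
    rcases g with _ | i <;> simp only [onLine] at h1 h2 <;> exact hne (by rw [h1, h2])
  refine Good.union adjk ?_ ?_ ?_ ?_ ?_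
  · rintro (l | g)
    · exact (hT l).on (U l) rfl
    · rcases hgrp g with h | h
      · apply Good.empty
        rintro x y ⟨hx, hy, hne⟩
        rw [Finset.card_eq_zero] at h
        rw [h] at hx hy
        simp [St] at hx hy
        exact hne (by rw [hx, hy])
      · exact h.on _ (Stcard _)
  · rintro (l | g) x y h
    · obtain ⟨p, q, c, d, h1, h2, h3, h4, h5⟩ := h
      exact ⟨q, p, d, c, h2, h1, h4, h3, h5.symm⟩
    · exact ⟨h.2.1, h.1, h.2.2.symm⟩
  · rintro (l | g) x y h
    · obtain ⟨p, q, c, d, rfl, rfl, h3, h4, h5⟩ := h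
      refine ⟨(Sts _ _ _).2 ((hU _ _).1 h3).1, (Sts _ _ _).2 ((hU _ _).1 h4).1, ?_⟩
      intro h
      have h := Option.some.inj h
      rw [Prod.mk.injEq] at h
      exact h5 h.1
    · obtain ⟨h1, h2, h3⟩ := h
      have key : ∀ x, x ∈ St (W.filter fun p => p.1 = g) → x ∈ St W := by
        rintro (_ | ⟨p, c⟩) hx
        · exact Stn _
        · rw [Sts] at hx ⊢
          exact (Finset.mem_filter.1 hx).1
      exact ⟨key _ h1, key _ h2, h3⟩
  · rintro (_ | ⟨p, c⟩) (_ | ⟨q, d⟩) ⟨hx, hy, hne⟩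
    · exact absurd rfl hne
    · rw [Sts] at hy
      exact ⟨.inr q.1, Stn _, (Sts _ _ _).2 (by simp [hy]), hne⟩
    · rw [Sts] at hx
      exact ⟨.inr p.1, (Sts _ _ _).2 (by simp [hx]), Stn _, hne⟩
    · rw [Sts] at hx hy
      by_cases h : p.1 = q.1
      · exact ⟨.inr p.1, (Sts _ _ _).2 (by simp [hx]), (Sts _ _ _).2 (by simp [hy, h]), hne⟩
      · obtain ⟨l, h1, h2⟩ := line_exists e he p q h
        exact ⟨.inl l, p, q, c, d, rfl, rfl, (hU _ _).2 ⟨hx, h1⟩, (hU _ _).2 ⟨hy, h2⟩,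
          fun h' => h (by rw [h'])⟩
  · have hgg : ∀ g g' x y, adjk (.inr g) x y → adjk (.inr g') x y → g = g' := by
      have key : ∀ g g' p c, some (p, c) ∈ St (W.filter fun p => p.1 = g) →
          some (p, c) ∈ St (W.filter fun p => p.1 = g') → g = g' := by
        intro g g' p c h1 h2
        rw [Sts] at h1 h2
        rw [← (Finset.mem_filter.1 h1).2, ← (Finset.mem_filter.1 h2).2]
      rintro g g' (_ | ⟨p, c⟩) y ⟨h1, h2, h3⟩ ⟨h4, h5, _⟩
      · rcases y with _ | ⟨q, d⟩
        · exact absurd rfl h3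
        · exact key _ _ _ _ h2 h5
      · exact key _ _ _ _ h1 h4
    have hlg' : ∀ l g x y, adjk (.inl l) x y → adjk (.inr g) x y → False := by
      rintro l g x y ⟨p, q, c, d, rfl, rfl, h3, h4, h5⟩ ⟨h6, h7, _⟩
      rw [Sts] at h6 h7
      apply hlg l p q h3 h4 h5
      rw [(Finset.mem_filter.1 h6).2, (Finset.mem_filter.1 h7).2]
    rintro x y (l | g) (l' | g') h h'
    · obtain ⟨p, q, c, d, rfl, rfl, h3, h4, h5⟩ := h
      obtain ⟨p', q', c', d', e1, e2, h3', h4', h5'⟩ := h'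
      have e1 := Option.some.inj e1
      have e2 := Option.some.inj e2
      rw [Prod.mk.injEq] at e1 e2
      obtain ⟨rfl, rfl⟩ := e1
      obtain ⟨rfl, rfl⟩ := e2
      rw [line_unique e he p q (hlg _ _ _ h3 h4 h5) l l' ((hU _ _).1 h3).2 ((hU _ _).1 h4).2
        ((hU _ _).1 h3').2 ((hU _ _).1 h4').2]
    · exact (hlg' _ _ _ _ h h').elim
    · exact (hlg' _ _ _ _ h' h).elim
    · rw [hgg _ _ _ _ h h']

/-- Truncation of two groups of a transversal design with eight groups. -/
theorem step8 {R : Type} [Fintype R] [CommRing R] (e : Fin 7 → R)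
    (he : ∀ i j, i ≠ j → IsUnit (e i - e j)) (hR : A (Fintype.card R)) (s t : ℕ)
    (hs : s = 0 ∨ A s) (ht : t = 0 ∨ A t) (hs' : s ≤ Fintype.card R) (ht' : t ≤ Fintype.card R) :
    A (6 * Fintype.card R + s + t) := by
  classical
  obtain ⟨X, hX⟩ := Finset.exists_subset_card_eq (s := (Finset.univ : Finset R)) (n := s) 
    (by simpa using hs')
  obtain ⟨Y, hY⟩ := Finset.exists_subset_card_eq (s := (Finset.univ : Finset R)) (n := t) 
    (by simpa using ht')
  let Z : Option (Fin 7) → Finset R := fun g => if g = none then X else if g = some 6 then Y else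
    Finset.univ
  let W : Finset (Option (Fin 7) × R) := Finset.univ.filter fun p => p.2 ∈ Z p.1
  have hW : ∀ g, (W.filter fun p => p.1 = g).card = (Z g).card := by
    intro g
    have : W.filter (fun p => p.1 = g) = (Z g).map ⟨fun r => (g, r), fun a b h => by simpa using h⟩ := by
      ext ⟨g', r⟩
      simp only [W, Finset.mem_filter, Finset.mem_univ, true_and, Finset.mem_map]
      constructor
      · rintro ⟨h, rfl⟩; exact ⟨r, h, rfl⟩
      · rintro ⟨a, h, he⟩
        obtain ⟨rfl, rfl⟩ := Prod.mk.inj he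
        exact ⟨h, rfl⟩
    rw [this, Finset.card_map]
  have hcard : W.card = 6 * Fintype.card R + s + t := by
    rw [Finset.card_eq_sum_card_fiberwise (f := fun p => p.1) (t := Finset.univ) (by simp)]
    simp only [hW]
    rw [Fintype.sum_option, Fin.sum_univ_castSucc]
    have z0 : Z none = X := by simp [Z]
    have z6 : Z (some (Fin.last 6)) = Y := by simp [Z, Fin.last]
    have z1 : ∀ i : Fin 6, Z (some i.castSucc) = Finset.univ := by
      intro i
      have : i.castSucc ≠ (6 : Fin 7) := (Fin.castSucc_lt_last i).ne
      simp [Z, this]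
    rw [z0, z6, hX.2, hY.2]
    simp only [z1, Finset.card_univ, Finset.sum_const, Fintype.card_fin, smul_eq_mul]
    ring
  rw [← hcard]
  apply step e he W
  · intro g
    rw [hW]
    by_cases h1 : g = none
    · simp only [Z, h1, if_true, hX.2]; exact hs
    · by_cases h2 : g = some 6
      · simp only [Z, h2, if_true, reduceCtorEq, if_false, hY.2]; exact ht
      · right
        simp only [Z, h1, h2, if_false, Finset.card_univ]
        exact hR
  · intro l
    refine ⟨W.filter (onLine e l), fun p => by simp, ?_⟩
    have hle : (W.filter (onLine e l)).card ≤ 8 := by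
      have : (W.filter (onLine e l)).card ≤ (Finset.univ : Finset (Option (Fin 7))).card := by
        apply Finset.card_le_card_of_injOn (fun p => p.1) (by simp)
        rintro ⟨g, r⟩ hp ⟨g', r'⟩ hq h
        replace h : g = g' := h
        subst h
        have h1 := (Finset.mem_filter.1 hp).2
        have h2 := (Finset.mem_filter.1 hq).2
        rcases g with _ | i <;> simp only [onLine] at h1 h2 <;> rw [h1, h2]
      simpa using this
    have hge : 6 ≤ (W.filter (onLine e l)).card := by
      have : (Finset.univ : Finset (Fin 6)).card ≤ (W.filter (onLine e l)).card := by
        apply Finset.card_le_card_of_injOn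
          (fun i => ((some i.castSucc, l.1 + e i.castSucc * l.2) : Option (Fin 7) × R))
        · intro i _
          have : i.castSucc ≠ (6 : Fin 7) := (Fin.castSucc_lt_last i).ne
          simp [W, Z, onLine, this]
        · intro i _ j _ h
          simp only [Prod.mk.injEq, Option.some.injEq] at h
          exact Fin.castSucc_injective _ h.1
      simpa using this
    generalize (W.filter (onLine e l)).card = n at hle hge
    interval_cases n
    · exact T6
    · exact T7
    · exact T8

theorem stepZ {n : ℕ} (hn : Nat.Coprime n 30) (hn7 : 7 ≤ n) (hA : A n) (s t : ℕ)
    (hs : s = 0 ∨ A s) (ht : t = 0 ∨ A t) (hs' : s ≤ n) (ht' : t ≤ n) : A (6 * n + s + t) := by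
  have : NeZero n := ⟨by omega⟩
  have h2 : Nat.Coprime n 2 := Nat.Coprime.coprime_dvd_right (by norm_num) hn
  have h3 : Nat.Coprime n 3 := Nat.Coprime.coprime_dvd_right (by norm_num) hn
  have h5 : Nat.Coprime n 5 := Nat.Coprime.coprime_dvd_right (by norm_num) hn
  have hu : ∀ d : ℕ, 0 < d → d < 7 → IsUnit ((d : ℕ) : ZMod n) := by
    intro d h1 h2'
    rw [ZMod.isUnit_iff_coprime, Nat.coprime_comm]
    interval_cases d
    · simp
    · exact h2
    · exact h3
    · exact Nat.Coprime.mul_right h2 h2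
    · exact h5
    · exact Nat.Coprime.mul_right h2 h3
  have key : ∀ i j : Fin 7, i < j → IsUnit (((j.val : ℕ) : ZMod n) - ((i.val : ℕ) : ZMod n)) := by
    intro i j hij
    have : i.val < j.val := hij
    rw [← Nat.cast_sub this.le]
    exact hu _ (by omega) (by omega)
  have := step8 (R := ZMod n) (fun i => ((i.val : ℕ) : ZMod n)) (by
    intro i j hne
    rcases lt_or_gt_of_ne hne with h | h
    · rw [← neg_sub]; exact (key i j h).neg
    · exact key j i h) (by rwa [ZMod.card]) s t hs ht (by rwa [ZMod.card]) (by rwa [ZMod.card])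
  rwa [ZMod.card] at this

theorem step9 (hA : A 9) (s t : ℕ)
    (hs : s = 0 ∨ A s) (ht : t = 0 ∨ A t) (hs' : s ≤ 9) (ht' : t ≤ 9) : A (54 + s + t) := by
  classical
  have : Fact (Nat.Prime 3) := ⟨Nat.prime_three⟩
  have : Fintype (GaloisField 3 2) := Fintype.ofFinite _
  have hc : Fintype.card (GaloisField 3 2) = 9 := by
    rw [← Nat.card_eq_fintype_card, GaloisField.card 3 2 (by norm_num)]; norm_num
  obtain ⟨f⟩ : Nonempty (Fin 7 ↪ GaloisField 3 2) := by
    apply Function.Embedding.nonempty_of_card_le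
    rw [hc]; simp
  have := step8 f (fun i j hne => 
    (sub_ne_zero.2 (fun h => hne (f.injective h))).isUnit) (by rwa [hc]) s t hs ht
    (by rwa [hc]) (by rwa [hc])
  rwa [hc] at this


/-- A convenient form of the recursion. -/
theorem stepR {n u : ℕ} (hn : Nat.Coprime n 30) (hn7 : 7 ≤ n) (h : ∀ w, 3 ≤ w → w ≤ n → A w)
    (h1 : 6 * n + 3 ≤ u) (h2 : u ≤ 8 * n) : A u := by
  have hA := h n (by omega) le_rfl
  by_cases c1 : u ≤ 7 * n
  · have := stepZ hn hn7 hA (u - 6 * n) 0 (.inr (h _ (by omega) (by omega))) (.inl rfl)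
      (by omega) (by omega)
    rwa [show 6 * n + (u - 6 * n) + 0 = u by omega] at this
  · by_cases c2 : 7 * n + 3 ≤ u
    · have := stepZ hn hn7 hA (u - 7 * n) n (.inr (h _ (by omega) (by omega))) (.inr hA)
        (by omega) (by omega)
      rwa [show 6 * n + (u - 7 * n) + n = u by omega] at this
    · have := stepZ hn hn7 hA (u - 7 * n + 3) (n - 3) (.inr (h _ (by omega) (by omega)))
        (.inr (h _ (by omega) (by omega))) (by omega) (by omega)
      rwa [show 6 * n + (u - 7 * n + 3) + (n - 3) = u by omega] at this

theorem stepR9 {u : ℕ} (h : ∀ w, 3 ≤ w → w ≤ 9 → A w)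
    (h1 : 57 ≤ u) (h2 : u ≤ 72) : A u := by
  have hA := h 9 (by omega) le_rfl
  by_cases c1 : u ≤ 63
  · have := step9 hA (u - 54) 0 (.inr (h _ (by omega) (by omega))) (.inl rfl)
      (by omega) (by omega)
    rwa [show 54 + (u - 54) + 0 = u by omega] at this
  · by_cases c2 : 66 ≤ u
    · have := step9 hA (u - 63) 9 (.inr (h _ (by omega) (by omega))) (.inr hA)
        (by omega) (by omega)
      rwa [show 54 + (u - 63) + 9 = u by omega] at this
    · have := step9 hA (u - 60) 6 (.inr (h _ (by omega) (by omega)))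
        (.inr (h _ (by omega) (by omega))) (by omega) (by omega)
      rwa [show 54 + (u - 60) + 6 = u by omega] at this

theorem A_small (u : ℕ) (h1 : 3 ≤ u) (h2 : u ≤ 44) (h3 : u ≠ 42) : A u := by
  interval_cases u
  · exact A_of_check des3_ok
  · exact A_of_check des4_ok
  · exact A_of_check des5_ok
  · exact A_of_check des6_ok
  · exact A_of_check des7_ok
  · exact A_of_check des8_ok
  · exact A_of_check des9_ok
  · exact A_of_check des10_ok
  · exact A_of_check des11_ok
  · exact A_of_check des12_ok
  · exact A_of_check des13_ok
  · exact A_of_check des14_ok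
  · exact A_of_check des15_ok
  · exact A_of_check des16_ok
  · exact A_of_check des17_ok
  · exact A_of_check des18_ok
  · exact A_of_check des19_ok
  · exact A_of_check des20_ok
  · exact A_of_check des21_ok
  · exact A_of_check des22_ok
  · exact A_of_check des23_ok
  · exact A_of_check des24_ok
  · exact A_of_check des25_ok
  · exact A_of_check des26_ok
  · exact A_of_check des27_ok
  · exact A_of_check des28_ok
  · exact A_of_check des29_ok
  · exact A_of_check des30_ok
  · exact A_of_check des31_ok
  · exact A_of_check des32_ok
  · exact A_of_check des33_ok
  · exact A_of_check des34_ok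
  · exact A_of_check des35_ok
  · exact A_of_check des36_ok
  · exact A_of_check des37_ok
  · exact A_of_check des38_ok
  · exact A_of_check des39_ok
  · exact A_of_check des40_ok
  · exact A_of_check des41_ok
  · exact absurd rfl h3
  · exact A_of_check des43_ok
  · exact A_of_check des44_ok

/-- Residues coprime to 30 leave gaps of length at most six. -/
theorem exists_coprime (m : ℕ) : ∃ n, m ≤ n ∧ n ≤ m + 5 ∧ Nat.Coprime n 30 := by
  have key : ∀ r : Fin 30, ∃ d : Fin 6, Nat.gcd ((r.val + d.val) % 30) 30 = 1 := by decide
  obtain ⟨d, hd⟩ := key ⟨m % 30, Nat.mod_lt _ (by norm_num)⟩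
  refine ⟨m + d.val, by omega, by omega, ?_⟩
  have e : (m % 30 + d.val) % 30 = (m + d.val) % 30 := by omega
  simp only [e] at hd
  rw [Nat.Coprime, ← hd, Nat.gcd_comm, Nat.gcd_rec]

theorem A_all (u : ℕ) (hu : 3 ≤ u) : A u := by
  induction u using Nat.strong_induction_on with
  | _ u ih =>
    have h : ∀ n, n < u → ∀ w, 3 ≤ w → w ≤ n → A w := fun n hn w h1 h2 => ih w (by omega) h1
    by_cases c0 : u = 42
    · subst c0
      exact stepZ (n := 7) (by norm_num) le_rfl (ih 7 (by omega) (by omega)) 0 0 (.inl rfl) (.inl rfl)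
        (by omega) (by omega)
    by_cases c1 : u ≤ 44
    · exact A_small u hu c1 c0
    by_cases c2 : u ≤ 56
    · exact stepR (n := 7) (by norm_num) (by omega) (h _ (by omega)) (by omega) (by omega)
    by_cases c3 : u ≤ 72
    · exact stepR9 (h _ (by omega)) (by omega) (by omega)
    by_cases c4 : u ≤ 88
    · exact stepR (n := 11) (by norm_num) (by omega) (h _ (by omega)) (by omega) (by omega)
    by_cases c5 : u ≤ 104
    · exact stepR (n := 13) (by norm_num) (by omega) (h _ (by omega)) (by omega) (by omega)
    by_cases c6 : u ≤ 136
    · exact stepR (n := 17) (by norm_num) (by omega) (h _ (by omega)) (by omega) (by omega)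
    by_cases c7 : u ≤ 152
    · exact stepR (n := 19) (by norm_num) (by omega) (h _ (by omega)) (by omega) (by omega)
    obtain ⟨n, h1, h2, hc⟩ := exists_coprime ((u + 7) / 8)
    exact stepR hc (by omega) (h _ (by omega)) (by omega) (by omega)

/-- For every integer `v` with `v ≡ 1 (mod 3)` and `v ≥ 10`, there exists a
super-simple `2-(v,4,2)` directed design in which every defining set contains
at least half of the blocks. -/
theorem exists_superSimple_DD_half (v : ℕ) (hv : v % 3 = 1) (hv10 : 10 ≤ v) :
    ∃ D : DirectedDesign (Fin v) 2 4 2, D.SuperSimple ∧ D.DefiningHalf := by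
  obtain ⟨u, rfl⟩ : ∃ u, v = 3 * u + 1 := ⟨v / 3, by omega⟩
  exact (A_all u (by omega)).design
end

section
/- If a t-(v,k,λ) directed design D = (V,B) contains m directed trades whose positive parts are pairwise disjoint subcollections of B, then every defining set of D contains at least m blocks. -/
/-- Every defining set meets the positive part of every trade contained in the design. -/
theorem exists_mem_pos_of_definingSet {X : Type*} [DecidableEq X]
    {t k lam : ℕ} (D : DirectedDesign X t k lam) (T : DirectedTrade X k t)
    (hsub : T.pos ≤ D.blocks)
    (S : Multiset (List X)) (hS : D.IsDefiningSet S) :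
    ∃ b ∈ S, b ∈ T.pos := by
  by_contra hcon
  push Not at hcon
  have hle : S ≤ D.blocks - T.pos := by
    rw [Multiset.le_iff_count]
    intro a
    rw [Multiset.count_sub]
    by_cases ha : a ∈ S
    · rw [Multiset.count_eq_zero_of_notMem (hcon a ha)]
      exact Multiset.le_iff_count.1 hS.1 a
    · rw [Multiset.count_eq_zero_of_notMem ha]
      exact Nat.zero_le _
  have hmem : ∀ b ∈ D.blocks - T.pos + T.neg, b ∈ D.blocks ∨ b ∈ T.neg := by
    intro b hb
    rcases Multiset.mem_add.1 hb with h | h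
    · exact Or.inl (Multiset.mem_of_le (Multiset.sub_le_self _ _) h)
    · exact Or.inr h
  let D' : DirectedDesign X t k lam :=
    { blocks := D.blocks - T.pos + T.neg
      len := fun b hb => (hmem b hb).elim (D.len b) (T.neg_len b)
      nodup := fun b hb => (hmem b hb).elim (D.nodup b) (T.neg_nodup b)
      covers := by
        intro s hs hn
        rw [Multiset.countP_add, ← T.balanced s hs hn, ← Multiset.countP_add,
          Multiset.sub_add_cancel hsub]
        exact D.covers s hs hn }
  have hEq : D.blocks - T.pos + T.neg = D.blocks :=
    hS.2 D' (hle.trans (Multiset.le_add_right _ _))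
  have hnp : T.neg = T.pos := by
    have h2 : D.blocks - T.pos + T.neg = D.blocks - T.pos + T.pos := by
      rw [hEq, Multiset.sub_add_cancel hsub]
    exact add_left_cancel h2
  obtain ⟨b, hb⟩ := Multiset.exists_mem_of_ne_zero T.pos_ne
  exact Multiset.disjoint_left.1 T.disjoint hb (hnp ▸ hb)

/-- If a `t-(v,k,λ)` directed design `D` contains `m` directed trades whose
positive parts are pairwise disjoint subcollections of the blocks of `D`,
then every defining set of `D` contains at least `m` blocks. -/
theorem definingSet_card_ge_of_disjoint_trades {X : Type*} [DecidableEq X]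
    {t k lam : ℕ} (D : DirectedDesign X t k lam) (m : ℕ)
    (T : Fin m → DirectedTrade X k t)
    (hsub : ∀ i, (T i).pos ≤ D.blocks)
    (hdisj : ∀ i j, i ≠ j → Disjoint (T i).pos (T j).pos)
    (S : Multiset (List X)) (hS : D.IsDefiningSet S) :
    m ≤ Multiset.card S := by
  choose f hfS hfT using fun i => exists_mem_pos_of_definingSet D (T i) (hsub i) S hS
  have hinj : Function.Injective f := by
    intro i j hij
    by_contra hne
    exact Multiset.disjoint_left.1 (hdisj i j hne) (hfT i) (hij ▸ hfT j)
  have h1 : (Finset.univ.image f).card ≤ S.toFinset.card :=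
    Finset.card_le_card (by
      intro b hb
      obtain ⟨i, -, rfl⟩ := Finset.mem_image.1 hb
      exact Multiset.mem_toFinset.2 (hfS i))
  rw [Finset.card_image_of_injective _ hinj, Finset.card_univ, Fintype.card_fin] at h1
  exact h1.trans (Multiset.toFinset_card_le S)
end

section
/- Let η ∈ {0,1}. If there exists a super-simple (k,λ)-DGDD of type g1^{u1}···gt^{ut} in which every defining set contains at least half of the blocks, and for each i with 1 ≤ i ≤ t there exists a super-simple 2-(g_i + η, k, λ) directed design in which every defining set contains at least half of the blocks, then there exists a super-simple 2-(Σ_{i=1}^t g_i·u_i + η, k, λ) directed design in which every defining set contains at least half of the blocks. -/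
/-- Partial directed design: admissible blocks `Q`, pairs to cover `R`. -/
def PV {Y : Type*} [DecidableEq Y] (Q : List Y → Prop) (R : Y → Y → Prop) (lam : ℕ)
    (B : Multiset (List Y)) : Prop :=
  (∀ b ∈ B, Q b) ∧ ∀ x y, x ≠ y →
    (R x y → B.countP (fun b => [x, y].Sublist b) = lam) ∧
    (¬ R x y → B.countP (fun b => [x, y].Sublist b) = 0)

/-- Half property for partial directed designs. -/
def PHalf {Y : Type*} [DecidableEq Y] (Q : List Y → Prop) (R : Y → Y → Prop) (lam : ℕ)
    (B : Multiset (List Y)) : Prop :=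
  ∀ S ≤ B, (∀ B', PV Q R lam B' → S ≤ B' → B' = B) → Multiset.card B ≤ 2 * Multiset.card S

/-- Super-simple property. -/
def PSS {Y : Type*} [DecidableEq Y] (B : Multiset (List Y)) : Prop :=
  B.Nodup ∧ ∀ b₁ ∈ B, ∀ b₂ ∈ B, b₁ ≠ b₂ → (b₁.toFinset ∩ b₂.toFinset).card ≤ 2

theorem lift_map {X Y : Type*} (f : X → Y) (B : Multiset Y) (h : ∀ b ∈ B, ∃ a, f a = b) :
    ∃ A : Multiset X, A.map f = B := by
  induction B using Multiset.induction_on with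
  | empty => exact ⟨0, rfl⟩
  | cons b B ih =>
    obtain ⟨A, hA⟩ := ih (fun c hc => h c (Multiset.mem_cons_of_mem hc))
    obtain ⟨a, ha⟩ := h b (Multiset.mem_cons_self _ _)
    exact ⟨a ::ₘ A, by simp [hA, ha]⟩

theorem pair_sublist_map {X Y : Type*} (f : X → Y) (hf : Function.Injective f) (a b : X)
    (l : List X) : [f a, f b].Sublist (l.map f) ↔ [a, b].Sublist l := by
  constructor
  · intro h
    obtain ⟨l', hl', he⟩ := List.sublist_map_iff.1 h
    have : [a, b] = l' := List.map_injective_iff.2 hf (by simpa using he)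
    rwa [this]
  · intro h
    simpa using h.map f

theorem count_map {X Y : Type*} [DecidableEq X] [DecidableEq Y] (f : X → Y)
    (hf : Function.Injective f) (a b : X)
    (B : Multiset (List X)) : (B.map (List.map f)).countP (fun c => [f a, f b].Sublist c) =
      B.countP (fun c => [a, b].Sublist c) := by
  rw [Multiset.countP_map, Multiset.countP_eq_card_filter]
  congr 1
  apply Multiset.filter_congr
  intro c _
  exact pair_sublist_map f hf a b c

/-- Transported block predicate. -/
def mQ {X Y : Type*} (f : X → Y) (Q : List X → Prop) (b : List Y) : Prop :=
  ∃ l, l.map f = b ∧ Q l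

/-- Transported pair relation. -/
def mR {X Y : Type*} (f : X → Y) (R : X → X → Prop) (x y : Y) : Prop :=
  ∃ a b, f a = x ∧ f b = y ∧ R a b

theorem PV_map {X Y : Type*} [DecidableEq X] [DecidableEq Y] (f : X → Y)
    (hf : Function.Injective f) (Q : List X → Prop) (R : X → X → Prop) (lam : ℕ)
    (B : Multiset (List X)) :
    PV (mQ f Q) (mR f R) lam (B.map (List.map f)) ↔ PV Q R lam B := by
  have hF : Function.Injective (List.map f) := List.map_injective_iff.2 hf
  constructor
  · rintro ⟨h1, h2⟩
    refine ⟨fun b hb => ?_, fun x y hxy => ?_⟩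
    · obtain ⟨l, hl, hq⟩ := h1 _ (Multiset.mem_map_of_mem _ hb)
      rwa [← hF hl]
    · have h := h2 (f x) (f y) (fun h => hxy (hf h))
      rw [count_map f hf] at h
      refine ⟨fun hr => h.1 ⟨x, y, rfl, rfl, hr⟩, fun hr => h.2 ?_⟩
      rintro ⟨a, b, ha, hb, hr'⟩
      rw [hf ha, hf hb] at hr'
      exact hr hr'
  · rintro ⟨h1, h2⟩
    refine ⟨fun b hb => ?_, fun x y hxy => ⟨?_, ?_⟩⟩
    · obtain ⟨l, hl, rfl⟩ := Multiset.mem_map.1 hb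
      exact ⟨l, rfl, h1 l hl⟩
    · rintro ⟨a, b, rfl, rfl, hr⟩
      rw [count_map f hf]
      exact (h2 a b (fun h => hxy (by rw [h]))).1 hr
    · intro hr
      by_contra hc
      obtain ⟨c, hc, hs⟩ := Multiset.countP_pos.1 (Nat.pos_of_ne_zero hc)
      obtain ⟨l, hl, rfl⟩ := Multiset.mem_map.1 hc
      have hx : x ∈ l.map f := hs.subset (by simp)
      have hy : y ∈ l.map f := hs.subset (by simp)
      obtain ⟨a, _, rfl⟩ := List.mem_map.1 hx
      obtain ⟨b, _, rfl⟩ := List.mem_map.1 hy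
      have hab : a ≠ b := fun h => hxy (by rw [h])
      have h0 := (h2 a b hab).2 (fun h => hr ⟨a, b, rfl, rfl, h⟩)
      rw [Multiset.countP_eq_zero] at h0
      exact h0 l hl ((pair_sublist_map f hf a b l).1 hs)

theorem PHalf_map {X Y : Type*} [DecidableEq X] [DecidableEq Y] (f : X → Y)
    (hf : Function.Injective f) (Q : List X → Prop) (R : X → X → Prop) (lam : ℕ)
    (B : Multiset (List X)) (h : PHalf Q R lam B) :
    PHalf (mQ f Q) (mR f R) lam (B.map (List.map f)) := by
  have hF : Function.Injective (List.map f) := List.map_injective_iff.2 hf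
  intro S hS hdef
  obtain ⟨S, rfl⟩ := lift_map (List.map f) S (fun b hb => by
    obtain ⟨l, _, hl⟩ := Multiset.mem_map.1 (Multiset.mem_of_le hS hb)
    exact ⟨l, hl⟩)
  have hS' : S ≤ B := (Multiset.map_le_map_iff hF).1 hS
  have := h S hS' (fun B' hB' hSB' =>
    Multiset.map_injective hF (hdef _ ((PV_map f hf Q R lam B').2 hB')
      (Multiset.map_le_map hSB')))
  simpa using this

theorem PSS_map {X Y : Type*} [DecidableEq X] [DecidableEq Y] (f : X → Y)
    (hf : Function.Injective f) (B : Multiset (List X)) (h : PSS B) :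
    PSS (B.map (List.map f)) := by
  have hF : Function.Injective (List.map f) := List.map_injective_iff.2 hf
  refine ⟨h.1.map hF, ?_⟩
  intro b₁ hb₁ b₂ hb₂ hne
  obtain ⟨l₁, h₁, rfl⟩ := Multiset.mem_map.1 hb₁
  obtain ⟨l₂, h₂, rfl⟩ := Multiset.mem_map.1 hb₂
  have := h.2 l₁ h₁ l₂ h₂ (fun h => hne (by rw [h]))
  have e : ∀ l : List X, (l.map f).toFinset = l.toFinset.image f := by
    intro l; ext; simp
  rw [e, e, ← Finset.image_inter _ _ hf, Finset.card_image_of_injective _ hf]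
  exact this

theorem countP_fsum {ι α : Type*} (p : α → Prop) [DecidablePred p] (s : Finset ι)
    (B : ι → Multiset α) : (∑ i ∈ s, B i).countP p = ∑ i ∈ s, (B i).countP p :=
  map_sum (Multiset.countPAddMonoidHom p) B s

theorem le_fsum {ι α : Type*} [DecidableEq ι] [DecidableEq α] (s : Finset ι)
    (B : ι → Multiset α) (S : Multiset α) (h : S ≤ ∑ i ∈ s, B i) :
    ∃ T : ι → Multiset α, (∀ i ∈ s, T i ≤ B i) ∧ S = ∑ i ∈ s, T i := by
  induction s using Finset.induction_on generalizing S with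
  | empty => exact ⟨B, by simp, by simpa using h⟩
  | insert a s ha ih =>
    rw [Finset.sum_insert ha] at h
    obtain ⟨T, hT, hS⟩ := ih (S - B a) (by rw [tsub_le_iff_left]; exact h)
    refine ⟨Function.update T a (S ∩ B a), ?_, ?_⟩
    · intro i hi
      by_cases hia : i = a
      · subst hia; simpa using Multiset.inter_le_right
      · rw [Function.update_of_ne hia]
        exact hT i ((Finset.mem_insert.1 hi).resolve_left hia)
    · rw [Finset.sum_insert ha, Function.update_self]
      rw [Finset.sum_congr rfl (g := T) (fun i hi => by
        rw [Function.update_of_ne]; rintro rfl; exact ha hi), ← hS]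
      rw [add_comm]
      exact (Multiset.sub_add_inter S (B a)).symm

theorem mem_pair {Y : Type*} [DecidableEq Y] (l : List Y) (x y : Y) (hx : x ∈ l) (hy : y ∈ l)
    (hxy : x ≠ y) : [x, y].Sublist l ∨ [y, x].Sublist l := by
  induction l with
  | nil => simp at hx
  | cons a l ih =>
    rcases List.mem_cons.1 hx with rfl | hx'
    · left
      have : y ∈ l := (List.mem_cons.1 hy).resolve_left (Ne.symm hxy)
      simpa using this
    · rcases List.mem_cons.1 hy with rfl | hy'
      · right
        simpa using hx'
      · exact (ih hx' hy').imp (fun h => h.cons _) (fun h => h.cons _)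

theorem PV_R {Y : Type*} [DecidableEq Y] {Q : List Y → Prop} {R : Y → Y → Prop} {lam : ℕ}
    {B : Multiset (List Y)} (h : PV Q R lam B) (hs : ∀ x y, R x y → R y x) (b : List Y)
    (hb : b ∈ B) (x y : Y) (hx : x ∈ b) (hy : y ∈ b) (hxy : x ≠ y) : R x y := by
  have key : ∀ x y, x ≠ y → [x, y].Sublist b → R x y := by
    intro x y hxy hsub
    by_contra hr
    have := (h.2 x y hxy).2 hr
    rw [Multiset.countP_eq_zero] at this
    exact this b hb hsub
  rcases mem_pair b x y hx hy hxy with h1 | h1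
  · exact key _ _ hxy h1
  · exact hs _ _ (key _ _ hxy.symm h1)

theorem glue {Y ι : Type*} [DecidableEq Y] [Fintype ι] [DecidableEq ι] (k lam : ℕ)
    (Q : ι → List Y → Prop) (R : ι → Y → Y → Prop) (B : ι → Multiset (List Y))
    (hQ : ∀ i b, Q i b → b.length = k ∧ b.Nodup)
    (hs : ∀ i x y, R i x y → R i y x)
    (hR : ∀ x y, x ≠ y → ∃! i, R i x y)
    (hV : ∀ i, PV (Q i) (R i) lam (B i))
    (hSS : ∀ i, PSS (B i)) (hH : ∀ i, PHalf (Q i) (R i) lam (B i)) :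
    ∃ D : DirectedDesign Y 2 k lam, D.SuperSimple ∧ D.DefiningHalf := by
  by_cases htriv : lam = 0 ∨ ∀ x y : Y, x = y
  · refine ⟨⟨0, by simp, by simp, ?_⟩, ?_, ?_⟩
    · intro s hs hn
      rcases htriv with rfl | h
      · simp
      · obtain ⟨x, y, rfl⟩ := List.length_eq_two.1 hs
        simp [h x y] at hn
    · simp [DirectedDesign.SuperSimple]
    · intro S _
      simp
  push Not at htriv
  obtain ⟨hlam, x₀, y₀, hxy₀⟩ := htriv
  have hk : 2 ≤ k := by
    obtain ⟨i, hi, _⟩ := hR x₀ y₀ hxy₀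
    have := ((hV i).2 x₀ y₀ hxy₀).1 hi
    obtain ⟨b, hb, hsub⟩ := Multiset.countP_pos.1 (by rw [this]; omega)
    rw [← (hQ i b ((hV i).1 b hb)).1]
    exact hsub.length_le
  -- gluing any valid family
  have mk : ∀ C : ι → Multiset (List Y), (∀ i, PV (Q i) (R i) lam (C i)) →
      ∃ D : DirectedDesign Y 2 k lam, D.blocks = ∑ i, C i := by
    intro C hC
    refine ⟨⟨∑ i, C i, ?_, ?_, ?_⟩, rfl⟩
    · intro b hb
      obtain ⟨i, _, hi⟩ := Multiset.mem_sum.1 hb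
      exact (hQ i b ((hC i).1 b hi)).1
    · intro b hb
      obtain ⟨i, _, hi⟩ := Multiset.mem_sum.1 hb
      exact (hQ i b ((hC i).1 b hi)).2
    · intro s hs hn
      obtain ⟨x, y, rfl⟩ := List.length_eq_two.1 hs
      have hxy : x ≠ y := by simpa using hn
      obtain ⟨i, hi, hu⟩ := hR x y hxy
      rw [countP_fsum, Finset.sum_eq_single i]
      · exact ((hC i).2 x y hxy).1 hi
      · intro j _ hj
        exact ((hC j).2 x y hxy).2 (fun h => hj (hu j h))
      · simp
  obtain ⟨D, hD⟩ := mk B hV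
  have cross : ∀ i j, i ≠ j → ∀ b ∈ B i, ∀ c ∈ B j, (b.toFinset ∩ c.toFinset).card ≤ 1 := by
    intro i j hij b hb c hc
    rw [Finset.card_le_one]
    intro x hx y hy
    by_contra hxy
    simp only [Finset.mem_inter, List.mem_toFinset] at hx hy
    exact hij ((hR x y hxy).unique (PV_R (hV i) (hs i) b hb x y hx.1 hy.1 hxy)
      (PV_R (hV j) (hs j) c hc x y hx.2 hy.2 hxy))
  have hdisj : ∀ i j, i ≠ j → ∀ b ∈ B i, b ∉ B j := by
    intro i j hij b hb hb'
    have h1 := cross i j hij b hb b hb'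
    have h2 := hQ i b ((hV i).1 b hb)
    rw [Finset.inter_self, List.toFinset_card_of_nodup h2.2, h2.1] at h1
    omega
  refine ⟨D, ⟨?_, ?_⟩, ?_⟩
  · rw [hD, Multiset.nodup_iff_count_le_one]
    intro b
    rw [Multiset.count_sum']
    by_cases hb : ∃ i, b ∈ B i
    · obtain ⟨i, hi⟩ := hb
      rw [Finset.sum_eq_single i]
      · exact Multiset.nodup_iff_count_le_one.1 (hSS i).1 b
      · intro j _ hj
        exact Multiset.count_eq_zero_of_notMem (hdisj i j (Ne.symm hj) b hi)
      · simp
    · push Not at hb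
      rw [Finset.sum_eq_zero (fun i _ => Multiset.count_eq_zero_of_notMem (hb i))]
      exact Nat.zero_le _
  · rw [hD]
    intro b hb c hc hne
    obtain ⟨i, _, hi⟩ := Multiset.mem_sum.1 hb
    obtain ⟨j, _, hj⟩ := Multiset.mem_sum.1 hc
    by_cases hij : i = j
    · subst hij
      exact (hSS i).2 b hi c hj hne
    · exact (cross i j hij b hi c hj).trans (by norm_num)
  · rintro S ⟨hS, hdef⟩
    rw [hD] at hS
    obtain ⟨T, hT, rfl⟩ := le_fsum Finset.univ B S hS
    rw [hD, Multiset.card_sum, Multiset.card_sum, Finset.mul_sum]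
    refine Finset.sum_le_sum (fun i _ => hH i (T i) (hT i (Finset.mem_univ i)) ?_)
    intro B' hB' hTB'
    obtain ⟨D', hD'⟩ := mk (Function.update B i B') (by
      intro j
      by_cases hj : j = i
      · subst hj; simpa using hB'
      · simpa [hj] using hV j)
    have := hdef D' (by
      rw [hD']
      refine Finset.sum_le_sum (fun j _ => ?_)
      by_cases hj : j = i
      · subst hj; simpa using hTB'
      · simpa [hj] using hT j (Finset.mem_univ j))
    rw [hD', hD, ← Finset.add_sum_erase _ _ (Finset.mem_univ i),
      ← Finset.add_sum_erase _ B (Finset.mem_univ i), Function.update_self,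
      Finset.sum_congr rfl (g := B) (fun j hj => by
        rw [Function.update_of_ne (Finset.ne_of_mem_erase hj)])] at this
    exact add_right_cancel this

theorem PV_DD {X : Type*} [DecidableEq X] (k lam : ℕ) (B : Multiset (List X)) :
    PV (fun b => b.length = k ∧ b.Nodup) (fun _ _ => True) lam B ↔
      ∃ D : DirectedDesign X 2 k lam, D.blocks = B := by
  constructor
  · rintro ⟨h1, h2⟩
    refine ⟨⟨B, fun b hb => (h1 b hb).1, fun b hb => (h1 b hb).2, ?_⟩, rfl⟩
    intro s hs hn
    obtain ⟨x, y, rfl⟩ := List.length_eq_two.1 hs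
    exact (h2 x y (by simpa using hn)).1 trivial
  · rintro ⟨D, rfl⟩
    refine ⟨fun b hb => ⟨D.len b hb, D.nodup b hb⟩, fun x y hxy => ⟨fun _ => ?_, by simp⟩⟩
    exact D.covers [x, y] rfl (by simpa using hxy)

/-- The admissible blocks of a DGDD. -/
def gQ {X : Type*} [DecidableEq X] (groups : Finset (Finset X)) (k : ℕ) (b : List X) : Prop :=
  b.length = k ∧ b.Nodup ∧ ∀ G ∈ groups, (b.toFinset ∩ G).card ≤ 1

/-- The pairs covered by a DGDD. -/
def gR {X : Type*} (groups : Finset (Finset X)) (x y : X) : Prop :=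
  ∀ G ∈ groups, ¬(x ∈ G ∧ y ∈ G)

theorem PV_DGDD {X : Type*} [DecidableEq X] (groups : Finset (Finset X)) (k lam : ℕ)
    (B : Multiset (List X)) :
    PV (gQ groups k) (gR groups) lam B ↔
      ∃ D : DGDD X groups k lam, D.blocks = B := by
  constructor
  · rintro ⟨h1, h2⟩
    exact ⟨⟨B, fun b hb => (h1 b hb).1, fun b hb => (h1 b hb).2.1, fun b hb => (h1 b hb).2.2,
      fun x y hxy => (h2 x y hxy).1⟩, rfl⟩
  · rintro ⟨D, rfl⟩
    refine ⟨fun b hb => ⟨D.len b hb, D.nodup b hb, D.transverse b hb⟩,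
      fun x y hxy => ⟨D.covers x y hxy, fun hr => ?_⟩⟩
    rw [Multiset.countP_eq_zero]
    intro b hb hsub
    apply hr
    rintro G hG ⟨hx, hy⟩
    have := Finset.card_le_one.1 (D.transverse b hb G hG) x
      (by simp [hx, hsub.subset (show x ∈ [x, y] by simp)]) y
      (by simp [hy, hsub.subset (show y ∈ [x, y] by simp)])
    exact hxy this

/-- If there exists a super-simple `(k,λ)`-DGDD of type `g₁^{u₁} ⋯ g_t^{u_t}`
with every defining set at least half of the blocks, and for each `i` a
super-simple `2-(gᵢ + η, k, λ)` directed design with every defining set at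
least half of the blocks (`η ∈ {0,1}`), then there is a super-simple
`2-(∑ gᵢuᵢ + η, k, λ)` directed design with every defining set at least
half of the blocks. -/
theorem superSimple_DD_of_DGDD_fill (k lam t η : ℕ) (hη : η = 0 ∨ η = 1)
    (g u : Fin t → ℕ)
    (hmaster : ∃ (groups : Finset (Finset (Fin (∑ i, g i * u i))))
        (D : DGDD (Fin (∑ i, g i * u i)) groups k lam),
        IsGroupPartition groups ∧
        Multiset.map Finset.card groups.val =
          ∑ i : Fin t, Multiset.replicate (u i) (g i) ∧
        D.SuperSimple ∧ D.DefiningHalf)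
    (hinput : ∀ i : Fin t,
        ∃ D : DirectedDesign (Fin (g i + η)) 2 k lam,
          D.SuperSimple ∧ D.DefiningHalf) :
    ∃ D : DirectedDesign (Fin ((∑ i, g i * u i) + η)) 2 k lam,
      D.SuperSimple ∧ D.DefiningHalf := by
  obtain ⟨groups, D, hpart, hcard, hDS, hDH⟩ := hmaster
  generalize hn : ∑ i, g i * u i = n at *
  have hfill : ∀ G : {G // G ∈ groups}, ∃ E : DirectedDesign (Fin (G.1.card + η)) 2 k lam,
      E.SuperSimple ∧ E.DefiningHalf := by
    rintro ⟨G, hG⟩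
    have : G.card ∈ Multiset.map Finset.card groups.val := Multiset.mem_map_of_mem _ hG
    rw [hcard, Multiset.mem_sum] at this
    obtain ⟨i, _, hi⟩ := this
    have := Multiset.eq_of_mem_replicate hi
    dsimp only
    rw [this]
    exact hinput i
  choose E hES hEH using hfill
  let T : {G // G ∈ groups} → Finset (Fin (n + η)) := fun G =>
    Finset.disjUnion (G.1.map (Fin.castAddEmb η)) (Finset.univ.map (Fin.natAddEmb n)) (by
      rw [Finset.disjoint_left]
      intro x hx hy
      obtain ⟨a, _, rfl⟩ := Finset.mem_map.1 hx
      obtain ⟨b, _, hb⟩ := Finset.mem_map.1 hy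
      have := congrArg Fin.val hb
      simp at this
      omega)
  have hT : ∀ G, (T G).card = G.1.card + η := by
    intro G
    dsimp only [T]
    rw [Finset.card_disjUnion]
    simp
  let f : (G : {G // G ∈ groups}) → Fin (G.1.card + η) → Fin (n + η) :=
    fun G => (T G).orderEmbOfFin (hT G)
  have hf : ∀ G, Function.Injective (f G) := fun G => ((T G).orderEmbOfFin (hT G)).injective
  have hfr : ∀ G x, (∃ a, f G a = x) ↔ x ∈ T G := by
    intro G x
    have := Finset.range_orderEmbOfFin (T G) (hT G)
    rw [← Finset.mem_coe, ← this]
    rfl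
  have hfR : ∀ G x y, mR (f G) (fun _ _ => True) x y ↔ x ∈ T G ∧ y ∈ T G := by
    intro G x y
    rw [← hfr, ← hfr]
    constructor
    · rintro ⟨a, b, ha, hb, _⟩
      exact ⟨⟨a, ha⟩, ⟨b, hb⟩⟩
    · rintro ⟨⟨a, ha⟩, ⟨b, hb⟩⟩
      exact ⟨a, b, ha, hb, trivial⟩
  have hTc : ∀ G a, Fin.castAdd η a ∈ T G ↔ a ∈ G.1 := by
    intro G a
    simp only [T, Finset.mem_disjUnion, Finset.mem_map, Finset.mem_univ, true_and]
    constructor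
    · rintro (⟨b, hb, h⟩ | ⟨b, h⟩)
      · have : b = a := Fin.castAdd_injective n η h
        rwa [← this]
      · have := congrArg Fin.val h
        simp at this
        omega
    · intro h
      exact Or.inl ⟨a, h, rfl⟩
  have hTn : ∀ G a, Fin.natAdd n a ∈ T G := by
    intro G a
    simp only [T, Finset.mem_disjUnion, Finset.mem_map, Finset.mem_univ, true_and]
    exact Or.inr ⟨a, rfl⟩
  have hci : Function.Injective (Fin.castAdd (n := n) η) := Fin.castAdd_injective n η
  have hne : ∀ a b, Fin.natAdd n (m := η) a ≠ Fin.castAdd η b := by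
    intro a b h
    have := congrArg Fin.val h
    simp at this
    omega
  refine glue (ι := Option {G // G ∈ groups}) k lam
    (fun i => match i with
      | none => mQ (Fin.castAdd η) (gQ groups k)
      | some G => mQ (f G) (fun b => b.length = k ∧ b.Nodup))
    (fun i => match i with
      | none => mR (Fin.castAdd η) (gR groups)
      | some G => mR (f G) (fun _ _ => True))
    (fun i => match i with
      | none => D.blocks.map (List.map (Fin.castAdd η))
      | some G => (E G).blocks.map (List.map (f G))) ?_ ?_ ?_ ?_ ?_ ?_
  · rintro (_ | G) b ⟨l, rfl, hl⟩
    · exact ⟨by simpa using hl.1, hl.2.1.map hci⟩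
    · exact ⟨by simpa using hl.1, hl.2.map (hf G)⟩
  · rintro (_ | G) x y ⟨a, b, rfl, rfl, h⟩
    · exact ⟨b, a, rfl, rfl, fun G hG h' => h G hG h'.symm⟩
    · exact ⟨b, a, rfl, rfl, trivial⟩
  · intro x y hxy
    have inf : ∀ (a : Fin n) (c : Fin η) (x y : Fin (n + η)),
        (x = Fin.castAdd η a ∧ y = Fin.natAdd n c) ∨ (y = Fin.castAdd η a ∧ x = Fin.natAdd n c) →
        ∃ G, (x ∈ T G ∧ y ∈ T G) ∧ (∀ G', x ∈ T G' ∧ y ∈ T G' → G' = G) ∧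
          ¬ mR (Fin.castAdd η) (gR groups) x y := by
      intro a c x y h
      obtain ⟨G, ⟨hG, haG⟩, hu⟩ := hpart a
      refine ⟨⟨G, hG⟩, ?_, ?_, ?_⟩
      · rcases h with ⟨rfl, rfl⟩ | ⟨rfl, rfl⟩ <;> simp [hTc, hTn, haG]
      · rintro ⟨G', hG'⟩ h'
        apply Subtype.ext
        apply hu
        rcases h with ⟨rfl, rfl⟩ | ⟨rfl, rfl⟩ <;> simp [hTc, hTn] at h' <;> exact ⟨hG', h'⟩
      · rintro ⟨a', b', ha', hb', _⟩
        rcases h with ⟨rfl, rfl⟩ | ⟨rfl, rfl⟩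
        · exact hne _ _ hb'.symm
        · exact hne _ _ ha'.symm
    have fin : (∃ G, (x ∈ T G ∧ y ∈ T G) ∧ (∀ G', x ∈ T G' ∧ y ∈ T G' → G' = G) ∧
          ¬ mR (Fin.castAdd η) (gR groups) x y) ∨
        (mR (Fin.castAdd η) (gR groups) x y ∧ ∀ G, ¬ (x ∈ T G ∧ y ∈ T G)) := by
      induction x using Fin.addCases with
      | left a =>
        induction y using Fin.addCases with
        | left b =>
          by_cases h : gR groups a b
          · right
            refine ⟨⟨a, b, rfl, rfl, h⟩, ?_⟩
            intro G
            rw [hTc, hTc]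
            exact h G.1 G.2
          · left
            have h' := h
            unfold gR at h
            push Not at h
            obtain ⟨G, hG, ha, hb⟩ := h
            refine ⟨⟨G, hG⟩, ?_, ?_, ?_⟩
            · simp [hTc, ha, hb]
            · rintro ⟨G', hG'⟩ h
              simp only [hTc] at h
              exact Subtype.ext ((hpart a).unique ⟨hG', h.1⟩ ⟨hG, ha⟩)
            · rintro ⟨a', b', ha', hb', h⟩
              rw [hci ha', hci hb'] at h
              exact h' h
        | right c => exact Or.inl (inf a c _ _ (Or.inl ⟨rfl, rfl⟩))
      | right c =>
        induction y using Fin.addCases with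
        | left b => exact Or.inl (inf b c _ _ (Or.inr ⟨rfl, rfl⟩))
        | right d =>
          exfalso
          apply hxy
          congr 1
          apply Fin.ext
          have := c.2
          have := d.2
          omega
    rcases fin with ⟨G, h1, h2, h3⟩ | ⟨h1, h2⟩
    · refine ⟨some G, (hfR G x y).2 h1, ?_⟩
      rintro (_ | G') h
      · exact absurd h h3
      · rw [h2 G' ((hfR G' x y).1 h)]
    · refine ⟨none, h1, ?_⟩
      rintro (_ | G') h
      · rfl
      · exact absurd ((hfR G' x y).1 h) (h2 G')
  · rintro (_ | G)
    · exact (PV_map _ hci _ _ _ _).2 ((PV_DGDD groups k lam _).2 ⟨D, rfl⟩)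
    · exact (PV_map _ (hf G) _ _ _ _).2 ((PV_DD k lam _).2 ⟨E G, rfl⟩)
  · rintro (_ | G)
    · exact PSS_map _ hci _ hDS
    · exact PSS_map _ (hf G) _ (hES G)
  · rintro (_ | G)
    · refine PHalf_map _ hci _ _ _ _ ?_
      intro S hS hdef
      exact hDH S ⟨hS, fun D' h => hdef _ ((PV_DGDD groups k lam _).2 ⟨D', rfl⟩) h⟩
    · refine PHalf_map _ (hf G) _ _ _ _ ?_
      intro S hS hdef
      exact hEH G S ⟨hS, fun D' h => hdef _ ((PV_DD k lam _).2 ⟨D', rfl⟩) h⟩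
end

section
/- If there exists a K-GDD of type g1^{u1}g2^{u2}···gn^{un}, a super-simple 2-(α·g_i + 1, 4, 2) directed design for each i = 1,2,...,n, and a super-simple (4,2)-DGDD of type α^k for each k ∈ K, then there exists a super-simple 2-(α·Σ_{i=1}^n g_i·u_i + 1, 4, 2) directed design. -/
/-- Auxiliary: a super-simple collection of ordered quadruples. -/
structure SSColl {P : Type*} [DecidableEq P] (C : Multiset (List P)) : Prop where
  nd : C.Nodup
  len : ∀ b ∈ C, b.length = 4
  bnd : ∀ b ∈ C, b.Nodup
  inter : ∀ b₁ ∈ C, ∀ b₂ ∈ C, b₁ ≠ b₂ → (b₁.toFinset ∩ b₂.toFinset).card ≤ 2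

lemma SSColl.map {X P : Type*} [DecidableEq X] [DecidableEq P] {C : Multiset (List X)}
    (h : SSColl C) (f : X → P) (hf : Function.Injective f) :
    SSColl (C.map (List.map f)) := by
  have hinj : Function.Injective (List.map f) := List.map_injective_iff.2 hf
  refine ⟨(Multiset.nodup_map_iff_of_injective hinj).2 h.nd, ?_, ?_, ?_⟩
  · intro b hb
    obtain ⟨c, hc, rfl⟩ := Multiset.mem_map.1 hb
    simpa using h.len c hc
  · intro b hb
    obtain ⟨c, hc, rfl⟩ := Multiset.mem_map.1 hb
    exact (h.bnd c hc).map hf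
  · intro b₁ hb₁ b₂ hb₂ hne
    obtain ⟨c₁, hc₁, rfl⟩ := Multiset.mem_map.1 hb₁
    obtain ⟨c₂, hc₂, rfl⟩ := Multiset.mem_map.1 hb₂
    have hne' : c₁ ≠ c₂ := fun e => hne (by rw [e])
    have e1 : ∀ c : List X, (c.map f).toFinset = c.toFinset.image f := by
      intro c; ext; simp
    rw [e1, e1, ← Finset.image_inter _ _ hf, Finset.card_image_of_injective _ hf]
    exact h.inter c₁ hc₁ c₂ hc₂ hne'

lemma countP_map_pair {X P : Type*} [DecidableEq X] [DecidableEq P] (C : Multiset (List X))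
    (f : X → P) (hf : Function.Injective f) (x y : X) :
    (C.map (List.map f)).countP (fun b => [f x, f y].Sublist b) =
      C.countP (fun b => [x, y].Sublist b) := by
  rw [Multiset.countP_map, Multiset.countP_eq_card_filter]
  congr 1
  apply Multiset.filter_congr
  intro b _
  constructor
  · intro h
    have h' : (List.map f [x, y]).Sublist (List.map f b) := h
    obtain ⟨l, hl, hl'⟩ := List.sublist_map_iff.1 h'
    have := List.map_injective_iff.2 hf hl'
    rw [this]; exact hl
  · intro h
    exact h.map f

/-- Gluing collections that pairwise share at most one point per block. -/
lemma glue_s4 {P ι : Type*} [DecidableEq P] [DecidableEq ι] (S : Finset ι)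
    (C : ι → Multiset (List P)) (hC : ∀ i ∈ S, SSColl (C i))
    (hd : ∀ i ∈ S, ∀ j ∈ S, i ≠ j → ∀ b ∈ C i, ∀ b' ∈ C j, ∀ x y,
      x ∈ b → x ∈ b' → y ∈ b → y ∈ b' → x = y)
    (hcov : ∀ x y : P, x ≠ y → ∃ i ∈ S, (C i).countP (fun b => [x, y].Sublist b) = 2) :
    SSColl (∑ i ∈ S, C i) ∧
      ∀ x y : P, x ≠ y → (∑ i ∈ S, C i).countP (fun b => [x, y].Sublist b) = 2 := by
  have hmem : ∀ b, b ∈ ∑ i ∈ S, C i ↔ ∃ i ∈ S, b ∈ C i := fun b => Multiset.mem_sum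
  have hcard : ∀ i ∈ S, ∀ j ∈ S, i ≠ j → ∀ b ∈ C i, ∀ b' ∈ C j,
      (b.toFinset ∩ b'.toFinset).card ≤ 1 := by
    intro i hi j hj hij b hb b' hb'
    rw [Finset.card_le_one]
    intro x hx y hy
    simp only [Finset.mem_inter, List.mem_toFinset] at hx hy
    exact hd i hi j hj hij b hb b' hb' x y hx.1 hx.2 hy.1 hy.2
  refine ⟨⟨?_, ?_, ?_, ?_⟩, ?_⟩
  · rw [Multiset.nodup_iff_count_le_one]
    intro b
    rw [Multiset.count_sum']
    by_cases h : ∃ i ∈ S, b ∈ C i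
    · obtain ⟨i, hi, hb⟩ := h
      rw [Finset.sum_eq_single_of_mem i hi]
      · exact Multiset.nodup_iff_count_le_one.1 (hC i hi).nd b
      · intro j hj hji
        rw [Multiset.count_eq_zero]
        intro hb'
        have h1 := hcard i hi j hj hji.symm b hb b hb'
        rw [Finset.inter_self, List.toFinset_card_of_nodup ((hC i hi).bnd b hb),
          (hC i hi).len b hb] at h1
        omega
    · push Not at h
      rw [Finset.sum_eq_zero]
      · omega
      · intro i hi
        exact Multiset.count_eq_zero.2 (h i hi)
  · intro b hb
    obtain ⟨i, hi, hb⟩ := (hmem b).1 hb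
    exact (hC i hi).len b hb
  · intro b hb
    obtain ⟨i, hi, hb⟩ := (hmem b).1 hb
    exact (hC i hi).bnd b hb
  · intro b₁ hb₁ b₂ hb₂ hne
    obtain ⟨i, hi, hb₁⟩ := (hmem b₁).1 hb₁
    obtain ⟨j, hj, hb₂⟩ := (hmem b₂).1 hb₂
    by_cases hij : i = j
    · subst hij
      exact (hC i hi).inter b₁ hb₁ b₂ hb₂ hne
    · exact (hcard i hi j hj hij b₁ hb₁ b₂ hb₂).trans (by omega)
  · intro x y hxy
    obtain ⟨i, hi, h2⟩ := hcov x y hxy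
    have hsum : (∑ i ∈ S, C i).countP (fun b => [x, y].Sublist b) =
        ∑ i ∈ S, (C i).countP (fun b => [x, y].Sublist b) :=
      map_sum (Multiset.countPAddMonoidHom (fun b => [x, y].Sublist b)) C S
    rw [hsum, Finset.sum_eq_single_of_mem i hi, h2]
    intro j hj hji
    rw [Multiset.countP_eq_zero]
    intro b' hb' hs'
    have hpos : 0 < (C i).countP (fun b => [x, y].Sublist b) := by omega
    obtain ⟨b, hb, hs⟩ := Multiset.countP_pos.1 hpos
    exact hxy (hd i hi j hj hji.symm b hb b' hb' x y (hs.subset (by simp))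
      (hs'.subset (by simp)) (hs.subset (by simp)) (hs'.subset (by simp)))

lemma group_comp {V : Type*} [DecidableEq V] (α : ℕ) (G : Finset V)
    (D : DirectedDesign (Fin (α * G.card + 1)) 2 4 2) (hD : D.SuperSimple) :
    ∃ C : Multiset (List (Option (V × Fin α))), SSColl C ∧
      (∀ b ∈ C, ∀ p, some p ∈ b → p.1 ∈ G) ∧
      ∀ x y : Option (V × Fin α), x ≠ y → (∀ p, some p = x → p.1 ∈ G) →
        (∀ p, some p = y → p.1 ∈ G) → C.countP (fun b => [x, y].Sublist b) = 2 := by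
  have hc : Fintype.card (Fin (α * G.card + 1)) = Fintype.card (Option (G × Fin α)) := by
    simp [mul_comm]
  let e := Fintype.equivOfCardEq hc
  let q : G × Fin α → V × Fin α := fun p => (p.1.1, p.2)
  have hq : Function.Injective q := by
    rintro ⟨⟨a, ha⟩, b⟩ ⟨⟨c, hc⟩, d⟩ h
    simpa [q] using h
  let f : Fin (α * G.card + 1) → Option (V × Fin α) := fun x => (e x).map q
  have hf : Function.Injective f := (Option.map_injective hq).comp e.injective
  have hsurj : ∀ x : Option (V × Fin α), (∀ p, some p = x → p.1 ∈ G) → ∃ z, f z = x := by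
    rintro (_ | p) h
    · exact ⟨e.symm none, by simp [f]⟩
    · exact ⟨e.symm (some (⟨p.1, h p rfl⟩, p.2)), by simp [f, q]⟩
  refine ⟨D.blocks.map (List.map f), SSColl.map ⟨hD.1, D.len, D.nodup, hD.2⟩ f hf, ?_, ?_⟩
  · intro b hb p hp
    obtain ⟨c, hc, rfl⟩ := Multiset.mem_map.1 hb
    obtain ⟨z, _, hz⟩ := List.mem_map.1 hp
    obtain ⟨w, _, hw⟩ := Option.map_eq_some_iff.1 hz
    rw [← hw]
    exact w.1.2
  · intro x y hxy hx hy
    obtain ⟨x, rfl⟩ := hsurj x hx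
    obtain ⟨y, rfl⟩ := hsurj y hy
    rw [countP_map_pair _ f hf]
    exact D.covers [x, y] rfl (by simpa using fun h => hxy (by rw [h]))

lemma block_comp {V : Type*} [DecidableEq V] (α : ℕ) (B : Finset V)
    (h : ∃ (groups : Finset (Finset (Fin (α * B.card))))
        (D : DGDD (Fin (α * B.card)) groups 4 2),
        IsGroupPartition groups ∧ groups.card = B.card ∧
        (∀ G ∈ groups, G.card = α) ∧ D.SuperSimple) :
    ∃ C : Multiset (List (Option (V × Fin α))), SSColl C ∧
      (∀ b ∈ C, ∀ x ∈ b, ∃ p, some p = x ∧ p.1 ∈ B) ∧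
      (∀ b ∈ C, ∀ p q, some p ∈ b → some q ∈ b → p.1 = q.1 → p = q) ∧
      ∀ p q : V × Fin α, p.1 ≠ q.1 → p.1 ∈ B → q.1 ∈ B →
        C.countP (fun b => [some p, some q].Sublist b) = 2 := by
  obtain ⟨groups, D, hp, hk, hα, hD⟩ := h
  choose gr hgr hgu using hp
  let gr' : Fin (α * B.card) → groups := fun x => ⟨gr x, (hgr x).1⟩
  let e1 : groups ≃ B := Fintype.equivOfCardEq (by simpa using hk)
  have hfib : ∀ G : groups, Nonempty ({x // gr' x = G} ≃ Fin α) := by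
    intro G
    refine ⟨Fintype.equivOfCardEq ?_⟩
    rw [Fintype.card_fin, Fintype.card_subtype]
    refine Eq.trans ?_ (hα G.1 G.2)
    congr 1
    ext x
    simp only [Finset.mem_filter, Finset.mem_univ, true_and]
    constructor
    · intro h
      rw [← h]; exact (hgr x).2
    · intro h
      exact Subtype.ext (hgu x G.1 ⟨G.2, h⟩).symm
  let e2 := fun G => (hfib G).some
  let e : Fin (α * B.card) ≃ B × Fin α :=
    (((Equiv.sigmaFiberEquiv gr').symm.trans (Equiv.sigmaCongrRight e2)).trans
      (Equiv.sigmaEquivProd groups (Fin α))).trans (Equiv.prodCongr e1 (Equiv.refl _))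
  have he : ∀ x, (e x).1 = e1 (gr' x) := fun x => rfl
  have hsame : ∀ x y, (e x).1 = (e y).1 → gr x = gr y := by
    intro x y h
    rw [he, he] at h
    exact congrArg Subtype.val (e1.injective h)
  let q : B × Fin α → V × Fin α := fun p => (p.1.1, p.2)
  have hq : Function.Injective q := by
    rintro ⟨⟨a, ha⟩, b⟩ ⟨⟨c, hc⟩, d⟩ h
    simpa [q] using h
  let f : Fin (α * B.card) → Option (V × Fin α) := fun x => some (q (e x))
  have hf : Function.Injective f := (Option.some_injective _).comp (hq.comp e.injective)
  have hsurj : ∀ p : V × Fin α, p.1 ∈ B → ∃ z, f z = some p := by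
    intro p h
    exact ⟨e.symm (⟨p.1, h⟩, p.2), by simp [f, q]⟩
  refine ⟨D.blocks.map (List.map f), SSColl.map ⟨hD.1, D.len, D.nodup, hD.2⟩ f hf, ?_, ?_, ?_⟩
  · intro b hb x hx
    obtain ⟨c, hc, rfl⟩ := Multiset.mem_map.1 hb
    obtain ⟨z, _, rfl⟩ := List.mem_map.1 hx
    exact ⟨_, rfl, (e z).1.2⟩
  · intro b hb p p' hp hp' hpp
    obtain ⟨c, hc, rfl⟩ := Multiset.mem_map.1 hb
    obtain ⟨z, hzc, hz⟩ := List.mem_map.1 hp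
    obtain ⟨w, hwc, hw⟩ := List.mem_map.1 hp'
    have hz := Option.some_injective _ hz
    have hw := Option.some_injective _ hw
    subst hz hw
    have hg := hsame z w (Subtype.ext hpp)
    have h1 := D.transverse c hc (gr z) (hgr z).1
    rw [Finset.card_le_one] at h1
    have : z = w := h1 z (by simpa using ⟨hzc, (hgr z).2⟩) w
      (by simpa using ⟨hwc, hg ▸ (hgr w).2⟩)
    rw [this]
  · intro p p' hne hpB hpB'
    obtain ⟨x, hx⟩ := hsurj p hpB
    obtain ⟨y, hy⟩ := hsurj p' hpB'
    rw [← hx, ← hy, countP_map_pair _ f hf]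
    have hx := Option.some_injective _ hx
    have hy := Option.some_injective _ hy
    apply D.covers x y
    · rintro rfl
      exact hne (by rw [← hx, ← hy])
    · rintro G hG ⟨h1, h2⟩
      apply hne
      rw [← hx, ← hy]
      change ((e x).1 : V) = (e y).1
      rw [he, he]
      have : gr' x = gr' y :=
        Subtype.ext ((hgu x G ⟨hG, h1⟩).symm.trans (hgu y G ⟨hG, h2⟩))
      rw [this]

/-- If there exists a `K`-GDD of type `g₁^{u₁} ⋯ g_n^{u_n}`, a super-simple
`2-(α·gᵢ + 1, 4, 2)` directed design for each `i`, and a super-simple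
`(4,2)`-DGDD of type `α^k` for each `k ∈ K`, then there exists a
super-simple `2-(α·∑ gᵢuᵢ + 1, 4, 2)` directed design. -/
theorem superSimple_DD_of_GDD_weighting (α n : ℕ) (K : Finset ℕ)
    (g u : Fin n → ℕ)
    (hGDD : ∃ (groups : Finset (Finset (Fin (∑ i, g i * u i))))
        (_ : GDD (Fin (∑ i, g i * u i)) groups K 1),
        IsGroupPartition groups ∧
        Multiset.map Finset.card groups.val =
          ∑ i : Fin n, Multiset.replicate (u i) (g i))
    (hDD : ∀ i : Fin n,
        ∃ D : DirectedDesign (Fin (α * g i + 1)) 2 4 2, D.SuperSimple)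
    (hDGDD : ∀ k ∈ K, ∃ (groups : Finset (Finset (Fin (α * k))))
        (D : DGDD (Fin (α * k)) groups 4 2),
        IsGroupPartition groups ∧ groups.card = k ∧
        (∀ G ∈ groups, G.card = α) ∧ D.SuperSimple) :
    ∃ D : DirectedDesign (Fin (α * (∑ i, g i * u i) + 1)) 2 4 2,
      D.SuperSimple := by
  obtain ⟨groups, D, hpart, htype⟩ := hGDD
  generalize hN : ∑ i, g i * u i = N at *
  have hG : ∀ G ∈ groups, ∃ D : DirectedDesign (Fin (α * G.card + 1)) 2 4 2,
      D.SuperSimple := by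
    intro G hG
    have h1 : G.card ∈ Multiset.map Finset.card groups.val :=
      Multiset.mem_map_of_mem _ hG
    rw [htype] at h1
    obtain ⟨i, _, hi⟩ := Multiset.mem_sum.1 h1
    rw [Multiset.eq_of_mem_replicate hi]
    exact hDD i
  have hGc := fun (G : Finset (Fin N)) (h : G ∈ groups) =>
    group_comp α G (hG G h).choose (hG G h).choose_spec
  have hBc := fun (B : Finset (Fin N)) (h : B ∈ D.blocks.toFinset) =>
    block_comp α B (hDGDD B.card (D.size_mem B (Multiset.mem_toFinset.1 h)))
  choose! CG hG1 hG2 hG3 using hGc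
  choose! CB hB1 hB2 hB3 hB4 using hBc
  have hgrp : ∀ x : Fin N, ∃ G ∈ groups, x ∈ G := fun x => by
    obtain ⟨G, h, _⟩ := hpart x
    exact ⟨G, h⟩
  have huniq : ∀ x : Fin N, ∀ G ∈ groups, ∀ G' ∈ groups, x ∈ G → x ∈ G' → G = G' :=
    fun x G h G' h' hx hx' => (hpart x).unique ⟨h, hx⟩ ⟨h', hx'⟩
  have hBG : ∀ B ∈ D.blocks.toFinset, ∀ G ∈ groups, ∀ x y, x ∈ B → y ∈ B → x ∈ G → y ∈ G →
      x = y := by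
    intro B hB G hG x y hx hy hx' hy'
    have h1 := D.transverse B (Multiset.mem_toFinset.1 hB) G hG
    rw [Finset.card_le_one] at h1
    exact h1 x (Finset.mem_inter.2 ⟨hx, hx'⟩) y (Finset.mem_inter.2 ⟨hy, hy'⟩)
  have hBB : ∀ B ∈ D.blocks.toFinset, ∀ B' ∈ D.blocks.toFinset, B ≠ B' → ∀ x y, x ∈ B → y ∈ B →
      x ∈ B' → y ∈ B' → x = y := by
    intro B hB B' hB' hne x y hx hy hx' hy'
    by_contra hxy
    have h1 := D.covers x y hxy (fun G hG h => hxy (hBG B hB G hG x y hx hy h.1 h.2))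
    rw [Multiset.countP_eq_card_filter] at h1
    obtain ⟨A, hA⟩ := Multiset.card_eq_one.1 h1
    have m1 : B ∈ D.blocks.filter (fun b => x ∈ b ∧ y ∈ b) :=
      Multiset.mem_filter.2 ⟨Multiset.mem_toFinset.1 hB, hx, hy⟩
    have m2 : B' ∈ D.blocks.filter (fun b => x ∈ b ∧ y ∈ b) :=
      Multiset.mem_filter.2 ⟨Multiset.mem_toFinset.1 hB', hx', hy'⟩
    rw [hA, Multiset.mem_singleton] at m1 m2
    exact hne (m1.trans m2.symm)
  have hmix : ∀ G ∈ groups, ∀ B ∈ D.blocks.toFinset, ∀ b ∈ CG G, ∀ b' ∈ CB B, ∀ x y,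
      x ∈ b → x ∈ b' → y ∈ b → y ∈ b' → x = y := by
    intro G hG B hB b hb b' hb' x y hx hx' hy hy'
    obtain ⟨p, rfl, hp⟩ := hB2 B hB b' hb' x hx'
    obtain ⟨q, rfl, hq⟩ := hB2 B hB b' hb' y hy'
    exact congrArg some (hB3 B hB b' hb' p q hx' hy' (hBG B hB G hG _ _ hp hq
      (hG2 G hG b hb p hx) (hG2 G hG b hb q hy)))
  obtain ⟨hS, hcov⟩ := glue_s4 (groups.disjSum D.blocks.toFinset) (Sum.elim CG CB)
    (by
      rintro (G | B) h
      · exact hG1 G (Finset.inl_mem_disjSum.1 h)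
      · exact hB1 B (Finset.inr_mem_disjSum.1 h))
    (by
      rintro (G | B) h (G' | B') h' hne b hb b' hb' x y hx hx' hy hy'
      · have h := Finset.inl_mem_disjSum.1 h
        have h' := Finset.inl_mem_disjSum.1 h'
        have hnone : ∀ z, z ∈ b → z ∈ b' → z = none := by
          rintro (_ | p) hz hz'
          · rfl
          · exact absurd (congrArg Sum.inl (huniq p.1 G h G' h' (hG2 G h b hb p hz)
              (hG2 G' h' b' hb' p hz'))) hne
        rw [hnone x hx hx', hnone y hy hy']
      · exact hmix G (Finset.inl_mem_disjSum.1 h) B' (Finset.inr_mem_disjSum.1 h')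
          b hb b' hb' x y hx hx' hy hy'
      · exact hmix G' (Finset.inl_mem_disjSum.1 h') B (Finset.inr_mem_disjSum.1 h)
          b' hb' b hb x y hx' hx hy' hy
      · have h := Finset.inr_mem_disjSum.1 h
        have h' := Finset.inr_mem_disjSum.1 h'
        obtain ⟨p, rfl, hp⟩ := hB2 B h b hb x hx
        obtain ⟨q, rfl, hq⟩ := hB2 B h b hb y hy
        obtain ⟨p', hpe, hp'⟩ := hB2 B' h' b' hb' _ hx'
        obtain ⟨q', hqe, hq'⟩ := hB2 B' h' b' hb' _ hy'
        rw [Option.some_injective _ hpe] at hp'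
        rw [Option.some_injective _ hqe] at hq'
        exact congrArg some (hB3 B h b hb p q hx hy
          (hBB B h B' h' (fun e => hne (by rw [e])) _ _ hp hq hp' hq')))
    (by
      intro x y hxy
      have key : ∀ G ∈ groups, (∀ p, some p = x → p.1 ∈ G) → (∀ p, some p = y → p.1 ∈ G) →
          ∃ i ∈ groups.disjSum D.blocks.toFinset,
            (Sum.elim CG CB i).countP (fun b => [x, y].Sublist b) = 2 := fun G h hx hy =>
        ⟨Sum.inl G, Finset.inl_mem_disjSum.2 h, hG3 G h x y hxy hx hy⟩
      rcases x with _ | p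
      · rcases y with _ | q
        · exact absurd rfl hxy
        · obtain ⟨G, h, hq⟩ := hgrp q.1
          exact key G h (by simp) (by rintro _ ⟨⟩; exact hq)
      · rcases y with _ | q
        · obtain ⟨G, h, hp⟩ := hgrp p.1
          exact key G h (by rintro _ ⟨⟩; exact hp) (by simp)
        · by_cases hs : ∃ G ∈ groups, p.1 ∈ G ∧ q.1 ∈ G
          · obtain ⟨G, h, hp, hq⟩ := hs
            exact key G h (by rintro _ ⟨⟩; exact hp) (by rintro _ ⟨⟩; exact hq)
          · have hs' : ∀ G ∈ groups, ¬ (p.1 ∈ G ∧ q.1 ∈ G) := fun G h h' => hs ⟨G, h, h'⟩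
            have hne : p.1 ≠ q.1 := by
              intro e
              obtain ⟨G, h, hp⟩ := hgrp p.1
              exact hs' G h ⟨hp, e ▸ hp⟩
            have h1 := D.covers p.1 q.1 hne hs'
            have hpos : 0 < D.blocks.countP (fun b => p.1 ∈ b ∧ q.1 ∈ b) := by omega
            obtain ⟨B, hB, hp, hq⟩ := Multiset.countP_pos.1 hpos
            have hB := Multiset.mem_toFinset.2 hB
            exact ⟨Sum.inr B, Finset.inr_mem_disjSum.2 hB, hB4 B hB p q hne hp hq⟩)
  have hc : Fintype.card (Option (Fin N × Fin α)) = Fintype.card (Fin (α * N + 1)) := by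
    simp [mul_comm]
  let e := Fintype.equivOfCardEq hc
  have hF := hS.map e e.injective
  refine ⟨⟨_, hF.len, hF.bnd, ?_⟩, hF.nd, hF.inter⟩
  intro s hs hnd
  obtain ⟨x, y, rfl⟩ := List.length_eq_two.1 hs
  obtain ⟨x, rfl⟩ := e.surjective x
  obtain ⟨y, rfl⟩ := e.surjective y
  rw [countP_map_pair _ e e.injective]
  apply hcov
  rintro rfl
  simp at hnd
end
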